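/- arXiv:1404.0170 — 5 statements merged into one kernel-verified Lean document; each statement's English description precedes it below -/
import Mathlib

section
/- The category of Poisson algebras over a field k has arbitrary coproducts; in particular, combined with the existence of coequalizers, it is cocomplete. -/
open TensorProduct

universe u v w x

/-- A Poisson (bracket) structure on a commutative `k`-algebra `A`: a bilinear,
alternating bracket satisfying the Jacobi and Leibniz identities. -/
structure PoissonStr (k : Type u) (A : Type v) [CommRing k] [CommRing A] [Algebra k A] where
  br : A →ₗ[k] A →ₗ[k] A
  br_self : ∀ a : A, br a a = 0
  jacobi : ∀ a b c : A, br a (br b c) = br (br a b) c + br b (br a c)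
  leibniz : ∀ a b c : A, br a (b * c) = br a b * c + b * br a c

/-- `f` is a morphism of Poisson algebras. -/
def IsPoissonHom {k : Type u} {A : Type v} {B : Type w} [CommRing k]
    [CommRing A] [Algebra k A] [CommRing B] [Algebra k B]
    (PA : PoissonStr k A) (PB : PoissonStr k B) (f : A →ₐ[k] B) : Prop :=
  ∀ a b : A, f (PA.br a b) = PB.br (f a) (f b)

/-- `T` is the tensor-product Poisson structure on `A ⊗[k] B`. -/
def IsTensorPoissonStr {k : Type u} {A : Type v} {B : Type w} [CommRing k]
    [CommRing A] [Algebra k A] [CommRing B] [Algebra k B]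
    (PA : PoissonStr k A) (PB : PoissonStr k B) (T : PoissonStr k (A ⊗[k] B)) : Prop :=
  ∀ (p r : A) (q s : B),
    T.br (p ⊗ₜ[k] q) (r ⊗ₜ[k] s) = (p * r) ⊗ₜ[k] PB.br q s + PA.br p r ⊗ₜ[k] (q * s)

/-- A coalgebra structure (as data) on a `k`-module `C`. -/
structure CoalgData (k : Type u) (C : Type v) [CommRing k] [AddCommGroup C] [Module k C] where
  comul : C →ₗ[k] C ⊗[k] C
  counit : C →ₗ[k] k
  coassoc : ∀ c : C, TensorProduct.map comul LinearMap.id (comul c) =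
    (TensorProduct.assoc k C C C).symm (TensorProduct.map LinearMap.id comul (comul c))
  counit_comul : ∀ c : C,
    TensorProduct.lid k C (TensorProduct.map counit LinearMap.id (comul c)) = c
  comul_counit : ∀ c : C,
    TensorProduct.rid k C (TensorProduct.map LinearMap.id counit (comul c)) = c

/-- `f` is a morphism of coalgebras. -/
def IsCoalgHom {k : Type u} {C : Type v} {D : Type w} [CommRing k]
    [AddCommGroup C] [Module k C] [AddCommGroup D] [Module k D]
    (DC : CoalgData k C) (DD : CoalgData k D) (f : C →ₗ[k] D) : Prop :=
  (∀ c : C, DD.comul (f c) = TensorProduct.map f f (DC.comul c)) ∧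
  (∀ c : C, DD.counit (f c) = DC.counit c)

/-- A (commutative) bialgebra structure (as data) on a commutative `k`-algebra `B`:
the comultiplication and the counit are algebra maps, the coalgebra axioms hold. -/
structure BialgData (k : Type u) (B : Type v) [CommRing k] [CommRing B] [Algebra k B] where
  comul : B →ₐ[k] B ⊗[k] B
  counit : B →ₐ[k] k
  coassoc : ∀ b : B,
    TensorProduct.map comul.toLinearMap LinearMap.id (comul b) =
      (TensorProduct.assoc k B B B).symm (TensorProduct.map LinearMap.id comul.toLinearMap (comul b))
  counit_comul : ∀ b : B,
    TensorProduct.lid k B (TensorProduct.map counit.toLinearMap LinearMap.id (comul b)) = b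
  comul_counit : ∀ b : B,
    TensorProduct.rid k B (TensorProduct.map LinearMap.id counit.toLinearMap (comul b)) = b

/-- The underlying coalgebra of a bialgebra. -/
def BialgData.toCoalgData {k : Type u} {B : Type v} [CommRing k] [CommRing B] [Algebra k B]
    (D : BialgData k B) : CoalgData k B where
  comul := D.comul.toLinearMap
  counit := D.counit.toLinearMap
  coassoc := D.coassoc
  counit_comul := D.counit_comul
  comul_counit := D.comul_counit

/-- A Hopf algebra structure (as data): a bialgebra together with an antipode. -/
structure HopfData (k : Type u) (B : Type v) [CommRing k] [CommRing B] [Algebra k B]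
    extends BialgData k B where
  antipode : B →ₗ[k] B
  antipode_comul : ∀ b : B,
    LinearMap.mul' k B (TensorProduct.map antipode LinearMap.id (comul b)) =
      algebraMap k B (counit b)
  comul_antipode : ∀ b : B,
    LinearMap.mul' k B (TensorProduct.map LinearMap.id antipode (comul b)) =
      algebraMap k B (counit b)

/-- The bialgebra `D` together with the Poisson structure `PS` is a Poisson bialgebra:
the comultiplication is a morphism of Poisson algebras into `B ⊗ B` with the tensor
Poisson structure. -/
def IsPoissonBialg {k : Type u} {B : Type v} [CommRing k] [CommRing B] [Algebra k B]
    (PS : PoissonStr k B) (D : BialgData k B) : Prop :=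
  ∃ T : PoissonStr k (B ⊗[k] B), IsTensorPoissonStr PS PS T ∧
    ∀ a b : B, D.comul (PS.br a b) = T.br (D.comul a) (D.comul b)

/-- `f` is a morphism of Poisson bialgebras. -/
def IsPoissonBialgHom {k : Type u} {A : Type v} {B : Type w} [CommRing k]
    [CommRing A] [Algebra k A] [CommRing B] [Algebra k B]
    (PA : PoissonStr k A) (PB : PoissonStr k B)
    (DA : BialgData k A) (DB : BialgData k B) (f : A →ₐ[k] B) : Prop :=
  IsPoissonHom PA PB f ∧
  (∀ a : A, DB.comul (f a) = TensorProduct.map f.toLinearMap f.toLinearMap (DA.comul a)) ∧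
  (∀ a : A, DB.counit (f a) = DA.counit a)

/-- `f` is a morphism of Poisson bialgebras into the opposite-coopposite. -/
def IsOpPoissonBialgHom {k : Type u} {A : Type v} {B : Type w} [CommRing k]
    [CommRing A] [Algebra k A] [CommRing B] [Algebra k B]
    (PA : PoissonStr k A) (PB : PoissonStr k B)
    (DA : BialgData k A) (DB : BialgData k B) (f : A →ₐ[k] B) : Prop :=
  (∀ a b : A, f (PA.br a b) = PB.br (f b) (f a)) ∧
  (∀ a : A, DB.comul (f a) =
    TensorProduct.comm k B B (TensorProduct.map f.toLinearMap f.toLinearMap (DA.comul a))) ∧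
  (∀ a : A, DB.counit (f a) = DA.counit a)

/-- A Poisson ideal: an associative ideal which is also a Lie ideal. -/
def IsPoissonIdeal {k : Type u} {Q : Type v} [CommRing k] [CommRing Q] [Algebra k Q]
    (PS : PoissonStr k Q) (I : Ideal Q) : Prop :=
  ∀ p : Q, ∀ a ∈ I, PS.br p a ∈ I

/-- The Poisson ideal generated by a set. -/
def poissonIdealGen {k : Type u} {Q : Type v} [CommRing k] [CommRing Q] [Algebra k Q]
    (PS : PoissonStr k Q) (S : Set Q) : Ideal Q :=
  sInf {I : Ideal Q | S ⊆ I ∧ IsPoissonIdeal PS I}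

/-- The subspace `Q ⊗ I + I ⊗ Q` of `Q ⊗ Q`. -/
def sweedlerSpan {k : Type u} {Q : Type v} [CommRing k] [CommRing Q] [Algebra k Q]
    (I : Submodule k Q) : Submodule k (Q ⊗[k] Q) :=
  LinearMap.range (TensorProduct.map LinearMap.id I.subtype) ⊔
    LinearMap.range (TensorProduct.map I.subtype LinearMap.id)

/-- A bundled Poisson algebra. -/
structure PoissonAlgBundle (k : Type u) [CommRing k] where
  carrier : Type v
  [ring : CommRing carrier]
  [alg : Algebra k carrier]
  str : PoissonStr k carrier

attribute [instance] PoissonAlgBundle.ring PoissonAlgBundle.alg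

/-- A bundled Poisson bialgebra. -/
structure PoissonBialgBundle (k : Type u) [CommRing k] extends PoissonAlgBundle.{u, v} k where
  bi : BialgData k carrier
  compat : IsPoissonBialg str bi

/-- A bundled Poisson Hopf algebra. -/
structure PoissonHopfBundle (k : Type u) [CommRing k] extends PoissonAlgBundle.{u, v} k where
  hopf : HopfData k carrier
  compat : IsPoissonBialg str hopf.toBialgData
namespace PCop

/-- Formal terms. -/
inductive Pre (k : Type u) [Field k] {ι : Type u} (P : ι → PoissonAlgBundle.{u, u} k) : Type u
  | of (i : ι) (a : (P i).carrier) : Pre k P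
  | const (c : k) : Pre k P
  | plus (a b : Pre k P) : Pre k P
  | times (a b : Pre k P) : Pre k P
  | brk (a b : Pre k P) : Pre k P

open Pre

/-- The relations imposed on terms. -/
inductive Rel (k : Type u) [Field k] {ι : Type u} (P : ι → PoissonAlgBundle.{u, u} k) :
    Pre k P → Pre k P → Prop
  | plus_l {a a' b} : Rel k P a a' → Rel k P (plus a b) (plus a' b)
  | plus_r {a b b'} : Rel k P b b' → Rel k P (plus a b) (plus a b')
  | times_l {a a' b} : Rel k P a a' → Rel k P (times a b) (times a' b)
  | times_r {a b b'} : Rel k P b b' → Rel k P (times a b) (times a b')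
  | brk_l {a a' b} : Rel k P a a' → Rel k P (brk a b) (brk a' b)
  | brk_r {a b b'} : Rel k P b b' → Rel k P (brk a b) (brk a b')
  | of_add (i) (a b : (P i).carrier) : Rel k P (of i (a + b)) (plus (of i a) (of i b))
  | of_mul (i) (a b : (P i).carrier) : Rel k P (of i (a * b)) (times (of i a) (of i b))
  | of_br (i) (a b : (P i).carrier) : Rel k P (of i ((P i).str.br a b)) (brk (of i a) (of i b))
  | of_const (i) (c : k) : Rel k P (of i (algebraMap k _ c)) (const c)
  | const_add (c d : k) : Rel k P (const (c + d)) (plus (const c) (const d))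
  | const_mul (c d : k) : Rel k P (const (c * d)) (times (const c) (const d))
  | add_comm (a b) : Rel k P (plus a b) (plus b a)
  | add_assoc (a b c) : Rel k P (plus (plus a b) c) (plus a (plus b c))
  | zero_add (a) : Rel k P (plus (const 0) a) a
  | neg_add (a) : Rel k P (plus (times (const (-1)) a) a) (const 0)
  | mul_comm (a b) : Rel k P (times a b) (times b a)
  | mul_assoc (a b c) : Rel k P (times (times a b) c) (times a (times b c))
  | one_mul (a) : Rel k P (times (const 1) a) a
  | mul_add (a b c) : Rel k P (times a (plus b c)) (plus (times a b) (times a c))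
  | zero_mul (a) : Rel k P (times (const 0) a) (const 0)
  | br_add (a b c) : Rel k P (brk a (plus b c)) (plus (brk a b) (brk a c))
  | add_br (a b c) : Rel k P (brk (plus a b) c) (plus (brk a c) (brk b c))
  | br_smul (c : k) (a b) : Rel k P (brk a (times (const c) b)) (times (const c) (brk a b))
  | smul_br (c : k) (a b) : Rel k P (brk (times (const c) a) b) (times (const c) (brk a b))
  | br_self (a) : Rel k P (brk a a) (const 0)
  | jacobi (a b c) : Rel k P (brk a (brk b c)) (plus (brk (brk a b) c) (brk b (brk a c)))
  | leibniz (a b c) : Rel k P (brk a (times b c)) (plus (times (brk a b) c) (times b (brk a c)))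

/-- The carrier of the coproduct. -/
def Cop (k : Type u) [Field k] {ι : Type u} (P : ι → PoissonAlgBundle.{u, u} k) : Type u :=
  Quot (Rel k P)

variable {k : Type u} [Field k] {ι : Type u} {P : ι → PoissonAlgBundle.{u, u} k}

/-- The quotient map. -/
def mk (a : Pre k P) : Cop k P := Quot.mk _ a

theorem mk_surj (x : Cop k P) : ∃ a, mk a = x := Quot.exists_rep x

theorem sound {a b : Pre k P} (h : Rel k P a b) : mk a = mk b := Quot.sound h

instance : Add (Cop k P) :=
  ⟨Quot.map₂ plus (fun _ _ _ h => Rel.plus_r h) (fun _ _ _ h => Rel.plus_l h)⟩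
instance : Mul (Cop k P) :=
  ⟨Quot.map₂ times (fun _ _ _ h => Rel.times_r h) (fun _ _ _ h => Rel.times_l h)⟩
instance : Zero (Cop k P) := ⟨mk (const 0)⟩
instance : One (Cop k P) := ⟨mk (const 1)⟩
instance : Neg (Cop k P) := ⟨fun a => mk (const (-1)) * a⟩

/-- The bracket. -/
def bra : Cop k P → Cop k P → Cop k P :=
  Quot.map₂ brk (fun _ _ _ h => Rel.brk_r h) (fun _ _ _ h => Rel.brk_l h)

theorem mk_plus (a b : Pre k P) : mk (plus a b) = mk a + mk b := rfl
theorem mk_times (a b : Pre k P) : mk (times a b) = mk a * mk b := rfl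
theorem mk_brk (a b : Pre k P) : mk (brk a b) = bra (mk a) (mk b) := rfl

theorem cadd_comm (x y : Cop k P) : x + y = y + x := by
  obtain ⟨a, rfl⟩ := mk_surj x
  obtain ⟨b, rfl⟩ := mk_surj y
  exact sound (Rel.add_comm a b)
theorem cadd_assoc (x y z : Cop k P) : x + y + z = x + (y + z) := by
  obtain ⟨a, rfl⟩ := mk_surj x
  obtain ⟨b, rfl⟩ := mk_surj y
  obtain ⟨c, rfl⟩ := mk_surj z
  exact sound (Rel.add_assoc a b c)
theorem czero_add (x : Cop k P) : 0 + x = x := by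
  obtain ⟨a, rfl⟩ := mk_surj x
  exact sound (Rel.zero_add a)
theorem cneg_add (x : Cop k P) : -x + x = 0 := by
  obtain ⟨a, rfl⟩ := mk_surj x
  exact sound (Rel.neg_add a)
theorem cmul_comm (x y : Cop k P) : x * y = y * x := by
  obtain ⟨a, rfl⟩ := mk_surj x
  obtain ⟨b, rfl⟩ := mk_surj y
  exact sound (Rel.mul_comm a b)
theorem cmul_assoc (x y z : Cop k P) : x * y * z = x * (y * z) := by
  obtain ⟨a, rfl⟩ := mk_surj x
  obtain ⟨b, rfl⟩ := mk_surj y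
  obtain ⟨c, rfl⟩ := mk_surj z
  exact sound (Rel.mul_assoc a b c)
theorem cone_mul (x : Cop k P) : 1 * x = x := by
  obtain ⟨a, rfl⟩ := mk_surj x
  exact sound (Rel.one_mul a)
theorem czero_mul (x : Cop k P) : 0 * x = 0 := by
  obtain ⟨a, rfl⟩ := mk_surj x
  exact sound (Rel.zero_mul a)
theorem cmul_add (x y z : Cop k P) : x * (y + z) = x * y + x * z := by
  obtain ⟨a, rfl⟩ := mk_surj x
  obtain ⟨b, rfl⟩ := mk_surj y
  obtain ⟨c, rfl⟩ := mk_surj z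
  exact sound (Rel.mul_add a b c)

instance : CommRing (Cop k P) where
  add_assoc := cadd_assoc
  zero_add := czero_add
  add_zero x := by rw [cadd_comm, czero_add]
  add_comm := cadd_comm
  nsmul := nsmulRec
  zsmul := zsmulRec
  neg_add_cancel := cneg_add
  mul_assoc := cmul_assoc
  one_mul := cone_mul
  mul_one x := by rw [cmul_comm, cone_mul]
  mul_comm := cmul_comm
  zero_mul := czero_mul
  mul_zero x := by rw [cmul_comm, czero_mul]
  left_distrib := cmul_add
  right_distrib x y z := by rw [cmul_comm, cmul_add, cmul_comm z, cmul_comm z]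

/-- Constants. -/
def constHom : k →+* Cop k P where
  toFun c := mk (const c)
  map_one' := rfl
  map_zero' := rfl
  map_add' c d := sound (Rel.const_add c d)
  map_mul' c d := sound (Rel.const_mul c d)

instance : Algebra k (Cop k P) := constHom.toAlgebra

theorem algebraMap_eq (c : k) : algebraMap k (Cop k P) c = mk (const c) := rfl

theorem csmul (c : k) (x : Cop k P) : c • x = mk (const c) * x := rfl

/-- The Poisson structure. -/
def str : PoissonStr k (Cop k P) where
  br := LinearMap.mk₂ k bra
    (fun x y z => by
      obtain ⟨a, rfl⟩ := mk_surj x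
      obtain ⟨b, rfl⟩ := mk_surj y
      obtain ⟨c, rfl⟩ := mk_surj z
      exact sound (Rel.add_br a b c))
    (fun c x y => by
      obtain ⟨a, rfl⟩ := mk_surj x
      obtain ⟨b, rfl⟩ := mk_surj y
      exact sound (Rel.smul_br c a b))
    (fun x y z => by
      obtain ⟨a, rfl⟩ := mk_surj x
      obtain ⟨b, rfl⟩ := mk_surj y
      obtain ⟨c, rfl⟩ := mk_surj z
      exact sound (Rel.br_add a b c))
    (fun c x y => by
      obtain ⟨a, rfl⟩ := mk_surj x
      obtain ⟨b, rfl⟩ := mk_surj y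
      exact sound (Rel.br_smul c a b))
  br_self x := by
    obtain ⟨a, rfl⟩ := mk_surj x
    exact sound (Rel.br_self a)
  jacobi x y z := by
    obtain ⟨a, rfl⟩ := mk_surj x
    obtain ⟨b, rfl⟩ := mk_surj y
    obtain ⟨c, rfl⟩ := mk_surj z
    exact sound (Rel.jacobi a b c)
  leibniz x y z := by
    obtain ⟨a, rfl⟩ := mk_surj x
    obtain ⟨b, rfl⟩ := mk_surj y
    obtain ⟨c, rfl⟩ := mk_surj z
    exact sound (Rel.leibniz a b c)

theorem mk_brk_str (a b : Pre k P) : mk (brk a b) = str.br (mk a) (mk b) := rfl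

/-- The coprojections. -/
def inj (i : ι) : (P i).carrier →ₐ[k] Cop k P where
  toFun a := mk (of i a)
  map_one' := by
    rw [← map_one (algebraMap k (P i).carrier)]
    exact sound (Rel.of_const i 1)
  map_zero' := by
    rw [← map_zero (algebraMap k (P i).carrier)]
    exact sound (Rel.of_const i 0)
  map_add' a b := sound (Rel.of_add i a b)
  map_mul' a b := sound (Rel.of_mul i a b)
  commutes' c := sound (Rel.of_const i c)

section lift

variable (R : PoissonAlgBundle.{u, u} k) (f : ∀ i, (P i).carrier →ₐ[k] R.carrier)

/-- Evaluation of terms. -/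
def ev : Pre k P → R.carrier
  | of i a => f i a
  | const c => algebraMap k _ c
  | plus a b => ev a + ev b
  | times a b => ev a * ev b
  | brk a b => R.str.br (ev a) (ev b)

theorem ev_rel (hf : ∀ i, IsPoissonHom (P i).str R.str (f i)) {a b : Pre k P}
    (h : Rel k P a b) : ev R f a = ev R f b := by
  induction h with
  | plus_l _ ih => simp only [ev, ih]
  | plus_r _ ih => simp only [ev, ih]
  | times_l _ ih => simp only [ev, ih]
  | times_r _ ih => simp only [ev, ih]
  | brk_l _ ih => simp only [ev, ih]
  | brk_r _ ih => simp only [ev, ih]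
  | of_br i a b => exact hf i a b
  | jacobi a b c => exact R.str.jacobi _ _ _
  | leibniz a b c => exact R.str.leibniz _ _ _
  | br_self a => simp [ev, R.str.br_self]
  | br_smul c a b => simp only [ev, ← Algebra.smul_def, map_smul]
  | smul_br c a b => simp only [ev, ← Algebra.smul_def, map_smul, LinearMap.smul_apply]
  | add_comm a b => exact _root_.add_comm _ _
  | mul_comm a b => exact _root_.mul_comm _ _
  | add_assoc a b c => exact _root_.add_assoc _ _ _
  | mul_assoc a b c => exact _root_.mul_assoc _ _ _
  | mul_add a b c => exact _root_.mul_add _ _ _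
  | _ => simp [ev]

/-- The induced map. -/
def lift (hf : ∀ i, IsPoissonHom (P i).str R.str (f i)) : Cop k P →ₐ[k] R.carrier where
  toFun := Quot.lift (ev R f) (fun _ _ h => ev_rel R f hf h)
  map_one' := map_one (algebraMap k R.carrier)
  map_zero' := map_zero (algebraMap k R.carrier)
  map_add' x y := by
    obtain ⟨a, rfl⟩ := mk_surj x
    obtain ⟨b, rfl⟩ := mk_surj y
    rfl
  map_mul' x y := by
    obtain ⟨a, rfl⟩ := mk_surj x
    obtain ⟨b, rfl⟩ := mk_surj y
    rfl
  commutes' c := rfl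

theorem eq_ev (v : Cop k P →ₐ[k] R.carrier) (hv : IsPoissonHom str R.str v)
    (hq : ∀ (i : ι) (x : (P i).carrier), v (inj i x) = f i x) (a : Pre k P) :
    v (mk a) = ev R f a := by
  induction a with
  | of i a => exact hq i a
  | const c => exact v.commutes c
  | plus a b iha ihb => rw [mk_plus, map_add, iha, ihb, ev]
  | times a b iha ihb => rw [mk_times, map_mul, iha, ihb, ev]
  | brk a b iha ihb => rw [mk_brk_str, hv, iha, ihb, ev]

end lift

end PCop

/-- the category of Poisson algebras has arbitrary coproducts;
in particular (combined with the existence of coequalizers) it is cocomplete. -/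
theorem poisson_coproducts (k : Type u) [Field k] (ι : Type u)
    (P : ι → PoissonAlgBundle.{u, u} k) :
    ∃ (C : PoissonAlgBundle.{u, u} k) (q : ∀ i, (P i).carrier →ₐ[k] C.carrier),
      (∀ i, IsPoissonHom (P i).str C.str (q i)) ∧
      ∀ (R : PoissonAlgBundle.{u, u} k) (u' : ∀ i, (P i).carrier →ₐ[k] R.carrier),
        (∀ i, IsPoissonHom (P i).str R.str (u' i)) →
        ∃! v : C.carrier →ₐ[k] R.carrier,
          IsPoissonHom C.str R.str v ∧ ∀ (i : ι) (x : (P i).carrier), v (q i x) = u' i x := by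
  refine ⟨⟨PCop.Cop k P, PCop.str⟩, PCop.inj, fun i a b => PCop.sound (PCop.Rel.of_br i a b), ?_⟩
  intro R f hf
  refine ⟨PCop.lift R f hf, ⟨?_, fun i x => rfl⟩, ?_⟩
  · intro x y
    obtain ⟨a, rfl⟩ := PCop.mk_surj x
    obtain ⟨b, rfl⟩ := PCop.mk_surj y
    rfl
  · rintro v ⟨hv, hq⟩
    apply AlgHom.ext
    intro x
    obtain ⟨a, rfl⟩ := PCop.mk_surj x
    exact PCop.eq_ev R f v hv hq a
end

section
/- Let f, g: P → Q be morphisms of Poisson Hopf algebras and let J̄ be the Poisson ideal of Q generated by {f(p) − g(p) : p ∈ P}. Then J̄ is stable under the antipode: S_Q(J̄) ⊆ J̄, so J̄ is a Poisson Hopf ideal and Q/J̄ with the canonical projection is the coequalizer of (f, g) in the category of Poisson Hopf algebras. -/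
open TensorProduct

universe u v w x

section Helpers

open WithConv

/-- The Mathlib coalgebra structure underlying `BialgData`. -/
@[reducible] def BialgData.coalg {k : Type u} {B : Type v} [CommRing k] [CommRing B] [Algebra k B]
    (D : BialgData k B) : Coalgebra k B where
  comul := D.comul.toLinearMap
  counit := D.counit.toLinearMap
  coassoc := by
    ext b
    have := congrArg (TensorProduct.assoc k B B B) (D.coassoc b)
    rw [LinearEquiv.apply_symm_apply] at this
    exact this
  rTensor_counit_comp_comul := by
    ext b
    apply (TensorProduct.lid k B).injective
    have := D.counit_comul b
    simpa [LinearMap.rTensor] using this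
  lTensor_counit_comp_comul := by
    ext b
    apply (TensorProduct.rid k B).injective
    have := D.comul_counit b
    simpa [LinearMap.lTensor] using this

theorem exists_rep {k : Type u} {B : Type v} [CommRing k] [CommRing B] [Algebra k B]
    (D : BialgData k B) (b : B) :
    ∃ s : Finset (B × B), D.comul b = ∑ i ∈ s, i.1 ⊗ₜ[k] i.2 :=
  TensorProduct.exists_finset _

/-- Cancellation of a right convolution-invertible map. -/
theorem conv_cancel {k : Type u} {C : Type v} {A : Type w} [CommRing k]
    [CommRing C] [Algebra k C] [CommRing A] [Algebra k A]
    (D : BialgData k C) (L φ ψ : C →ₗ[k] A)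
    (hinv : ∀ c, LinearMap.mul' k A (TensorProduct.map φ ψ (D.comul c)) =
      algebraMap k A (D.counit c))
    (hL : ∀ (c : C) (s : Finset (C × C)), D.comul c = ∑ i ∈ s, i.1 ⊗ₜ[k] i.2 →
      ∑ i ∈ s, L i.1 * φ i.2 = 0) : ∀ c, L c = 0 := by
  letI := D.coalg
  have h1 : toConv φ * toConv ψ = 1 := by
    ext c
    exact hinv c
  have h2 : toConv L * toConv φ = 0 := by
    ext c
    obtain ⟨s, hs⟩ := exists_rep D c
    have h3 := hL c s hs
    change LinearMap.mul' k A (TensorProduct.map L φ (D.comul c)) = 0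
    rw [hs]
    simpa using h3
  have h4 : toConv L = 0 := by
    calc toConv L = toConv L * (toConv φ * toConv ψ) := by rw [h1, mul_one]
      _ = 0 := by rw [← mul_assoc, h2, zero_mul]
  intro c
  have : L = 0 := congrArg WithConv.ofConv h4
  simp [this]

variable {k : Type u} {B : Type v} [CommRing k] [CommRing B] [Algebra k B]

theorem conv_cancel_two (D : HopfData k B) (Z : B →ₗ[k] B →ₗ[k] B)
    (hZ : ∀ (a b : B) (s t : Finset (B × B)), D.comul a = ∑ i ∈ s, i.1 ⊗ₜ[k] i.2 →
      D.comul b = ∑ j ∈ t, j.1 ⊗ₜ[k] j.2 →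
      ∑ i ∈ s, ∑ j ∈ t, Z i.1 j.1 * (i.2 * j.2) = 0) : ∀ a b, Z a b = 0 := by
  intro a
  refine conv_cancel D.toBialgData (Z a) LinearMap.id D.antipode D.comul_antipode ?_
  intro b t ht
  let L : B →ₗ[k] B := ∑ j ∈ t, (LinearMap.mulRight k j.2) ∘ₗ (Z.flip j.1)
  have hLa : ∀ a, L a = ∑ j ∈ t, Z a j.1 * j.2 := by
    intro a
    simp [L]
  have := conv_cancel D.toBialgData L LinearMap.id D.antipode D.comul_antipode (by
    intro a s hs
    rw [← hZ a b s t hs ht]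
    refine Finset.sum_congr rfl fun i _ => ?_
    rw [hLa, Finset.sum_mul]
    refine Finset.sum_congr rfl fun j _ => ?_
    simp only [LinearMap.id_apply]
    ring) a
  rw [hLa] at this
  simpa using this

theorem antipode_rep (D : HopfData k B) {a : B} {s : Finset (B × B)}
    (hs : D.comul a = ∑ i ∈ s, i.1 ⊗ₜ[k] i.2) :
    ∑ i ∈ s, D.antipode i.1 * i.2 = algebraMap k B (D.counit a) := by
  rw [← D.antipode_comul, hs]
  simp

theorem hopf_antipode_mul (D : HopfData k B) (a b : B) :
    D.antipode (a * b) = D.antipode a * D.antipode b := by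
  have := conv_cancel_two D ((LinearMap.mul k B).compr₂ D.antipode -
    (LinearMap.mul k B).compl₁₂ D.antipode D.antipode) (by
    intro a b s t hs ht
    have h1 : ∑ i ∈ s, ∑ j ∈ t, D.antipode (i.1 * j.1) * (i.2 * j.2) =
        algebraMap k B (D.counit (a * b)) := by
      rw [← D.antipode_comul, map_mul, hs, ht, Finset.sum_mul_sum]
      simp
    have h2 : ∑ i ∈ s, ∑ j ∈ t, D.antipode i.1 * D.antipode j.1 * (i.2 * j.2) =
        algebraMap k B (D.counit (a * b)) := by
      rw [map_mul, map_mul, ← antipode_rep D hs, ← antipode_rep D ht, Finset.sum_mul_sum]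
      refine Finset.sum_congr rfl fun i _ => Finset.sum_congr rfl fun j _ => ?_
      ring
    simp only [LinearMap.sub_apply, LinearMap.compr₂_apply, LinearMap.mul_apply',
      LinearMap.compl₁₂_apply, sub_mul, Finset.sum_sub_distrib]
    rw [h1, h2, sub_self]) a b
  simpa [sub_eq_zero] using this

theorem PoissonStr.skew (PS : PoissonStr k B) (a b : B) : PS.br a b = - PS.br b a := by
  have h := PS.br_self (a + b)
  simp only [map_add, LinearMap.add_apply, PS.br_self, zero_add, add_zero] at h
  exact eq_neg_of_add_eq_zero_right h

theorem PoissonStr.br_one (PS : PoissonStr k B) (a : B) : PS.br a 1 = 0 := by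
  have h := PS.leibniz a 1 1
  simpa using h

theorem PoissonStr.br_algebraMap (PS : PoissonStr k B) (a : B) (c : k) :
    PS.br a (algebraMap k B c) = 0 := by
  rw [Algebra.algebraMap_eq_smul_one, map_smul, PS.br_one, smul_zero]

/-- Sweedler form of compatibility of the bracket and the coproduct. -/
theorem comul_br_rep {PS : PoissonStr k B} {D : BialgData k B} (h : IsPoissonBialg PS D)
    {a b : B} {s t : Finset (B × B)} (hs : D.comul a = ∑ i ∈ s, i.1 ⊗ₜ[k] i.2)
    (ht : D.comul b = ∑ j ∈ t, j.1 ⊗ₜ[k] j.2) :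
    D.comul (PS.br a b) = ∑ i ∈ s, ∑ j ∈ t,
      ((i.1 * j.1) ⊗ₜ[k] PS.br i.2 j.2 + PS.br i.1 j.1 ⊗ₜ[k] (i.2 * j.2)) := by
  obtain ⟨T, hT, hc⟩ := h
  rw [hc, hs, ht]
  simp only [map_sum, LinearMap.sum_apply]
  rw [Finset.sum_comm]
  refine Finset.sum_congr rfl fun i _ => Finset.sum_congr rfl fun j _ => ?_
  rw [hT]

theorem counit_rep_left (D : BialgData k B) {a : B} {s : Finset (B × B)}
    (hs : D.comul a = ∑ i ∈ s, i.1 ⊗ₜ[k] i.2) : ∑ i ∈ s, D.counit i.1 • i.2 = a := by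
  conv_rhs => rw [← D.counit_comul a, hs]
  simp

theorem counit_rep_right (D : BialgData k B) {a : B} {s : Finset (B × B)}
    (hs : D.comul a = ∑ i ∈ s, i.1 ⊗ₜ[k] i.2) : ∑ i ∈ s, D.counit i.2 • i.1 = a := by
  conv_rhs => rw [← D.comul_counit a, hs]
  simp

theorem counit_br {PS : PoissonStr k B} {D : BialgData k B} (h : IsPoissonBialg PS D)
    (a b : B) : D.counit (PS.br a b) = 0 := by
  obtain ⟨s, hs⟩ := exists_rep D a
  obtain ⟨t, ht⟩ := exists_rep D b
  have e := congrArg D.counit (D.counit_comul (PS.br a b))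
  rw [comul_br_rep h hs ht] at e
  simp only [map_sum, map_add, TensorProduct.map_tmul, TensorProduct.lid_tmul,
    AlgHom.toLinearMap_apply, LinearMap.id_apply, map_smul, map_mul, smul_eq_mul,
    Finset.sum_add_distrib] at e
  have e1 : ∑ i ∈ s, ∑ j ∈ t, D.counit i.1 * D.counit j.1 * D.counit (PS.br i.2 j.2) =
      D.counit (PS.br a b) := by
    conv_rhs => rw [← counit_rep_left D hs, ← counit_rep_left D ht]
    simp only [map_sum, LinearMap.sum_apply, map_smul, LinearMap.smul_apply, smul_eq_mul,
      Finset.mul_sum]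
    rw [Finset.sum_comm]
    refine Finset.sum_congr rfl fun i _ => Finset.sum_congr rfl fun j _ => ?_
    ring
  have e2 : ∑ i ∈ s, ∑ j ∈ t, D.counit (PS.br i.1 j.1) * (D.counit i.2 * D.counit j.2) =
      D.counit (PS.br a b) := by
    conv_rhs => rw [← counit_rep_right D hs, ← counit_rep_right D ht]
    simp only [map_sum, LinearMap.sum_apply, map_smul, LinearMap.smul_apply, smul_eq_mul,
      Finset.mul_sum]
    rw [Finset.sum_comm]
    refine Finset.sum_congr rfl fun i _ => Finset.sum_congr rfl fun j _ => ?_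
    ring
  rw [e1, e2] at e
  simpa using e

theorem br_antipode_rep (PS : PoissonStr k B) (D : HopfData k B) {a : B} {s : Finset (B × B)}
    (hs : D.comul a = ∑ i ∈ s, i.1 ⊗ₜ[k] i.2) (y : B) :
    ∑ i ∈ s, PS.br y (D.antipode i.1) * i.2 = - ∑ i ∈ s, D.antipode i.1 * PS.br y i.2 := by
  have := congrArg (PS.br y) (antipode_rep D hs)
  simp only [map_sum, PS.br_algebraMap, PS.leibniz, Finset.sum_add_distrib] at this
  exact eq_neg_of_add_eq_zero_left this

theorem hopf_antipode_br {PS : PoissonStr k B} {D : HopfData k B}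
    (h : IsPoissonBialg PS D.toBialgData) (a b : B) :
    D.antipode (PS.br a b) = PS.br (D.antipode b) (D.antipode a) := by
  have := conv_cancel_two D (PS.br.compr₂ D.antipode +
    PS.br.compl₁₂ D.antipode D.antipode) (by
    intro a b s t hs ht
    have h1 := D.antipode_comul (PS.br a b)
    rw [counit_br h, comul_br_rep h hs ht] at h1
    simp only [map_sum, map_add, TensorProduct.map_tmul, LinearMap.mul'_apply, map_zero,
      LinearMap.id_apply, Finset.sum_add_distrib, hopf_antipode_mul] at h1
    have h2 : ∑ i ∈ s, ∑ j ∈ t, PS.br (D.antipode i.1) (D.antipode j.1) * (i.2 * j.2) =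
        ∑ i ∈ s, ∑ j ∈ t, D.antipode i.1 * D.antipode j.1 * PS.br i.2 j.2 := by
      calc _ = ∑ i ∈ s, i.2 * ∑ j ∈ t, PS.br (D.antipode i.1) (D.antipode j.1) * j.2 := by
            refine Finset.sum_congr rfl fun i _ => ?_
            rw [Finset.mul_sum]
            refine Finset.sum_congr rfl fun j _ => ?_
            ring
        _ = ∑ i ∈ s, ∑ j ∈ t, D.antipode j.1 * (PS.br j.2 (D.antipode i.1) * i.2) := by
            refine Finset.sum_congr rfl fun i _ => ?_
            rw [br_antipode_rep PS D ht, ← Finset.sum_neg_distrib, Finset.mul_sum]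
            refine Finset.sum_congr rfl fun j _ => ?_
            rw [PS.skew (D.antipode i.1)]
            ring
        _ = ∑ j ∈ t, D.antipode j.1 * ∑ i ∈ s, PS.br j.2 (D.antipode i.1) * i.2 := by
            rw [Finset.sum_comm]
            simp only [Finset.mul_sum]
        _ = ∑ j ∈ t, ∑ i ∈ s, D.antipode i.1 * D.antipode j.1 * PS.br i.2 j.2 := by
            refine Finset.sum_congr rfl fun j _ => ?_
            rw [br_antipode_rep PS D hs, ← Finset.sum_neg_distrib, Finset.mul_sum]
            refine Finset.sum_congr rfl fun i _ => ?_
            rw [PS.skew j.2]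
            ring
        _ = _ := Finset.sum_comm
    simp only [LinearMap.add_apply, LinearMap.compr₂_apply,
      LinearMap.compl₁₂_apply, add_mul, Finset.sum_add_distrib]
    rw [h2, add_comm]
    exact h1) a b
  simp only [LinearMap.add_apply, LinearMap.compr₂_apply, LinearMap.compl₁₂_apply] at this
  rw [PS.skew (D.antipode b)]
  exact eq_neg_of_add_eq_zero_left this

theorem hom_antipode {A : Type w} [CommRing A] [Algebra k A] (DA : HopfData k A)
    (DB : HopfData k B) (f : A →ₐ[k] B)
    (hc : ∀ a, DB.comul (f a) = TensorProduct.map f.toLinearMap f.toLinearMap (DA.comul a))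
    (he : ∀ a, DB.counit (f a) = DA.counit a) (a : A) :
    DB.antipode (f a) = f (DA.antipode a) := by
  have := conv_cancel DA.toBialgData
    (DB.antipode ∘ₗ f.toLinearMap - f.toLinearMap ∘ₗ DA.antipode) f.toLinearMap
    (f.toLinearMap ∘ₗ DA.antipode) (by
      intro c
      obtain ⟨s, hs⟩ := exists_rep DA.toBialgData c
      have h1 := congrArg f (DA.comul_antipode c)
      rw [hs] at h1 ⊢
      simpa using h1) (by
      intro c s hs
      have h1 := congrArg f (antipode_rep DA hs)
      have h2 := DB.antipode_comul (f c)
      rw [hc, hs, he] at h2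
      simp only [map_sum, map_mul, AlgHom.commutes] at h1
      simp only [map_sum, TensorProduct.map_tmul, LinearMap.mul'_apply,
        AlgHom.toLinearMap_apply, LinearMap.id_apply] at h2
      simp only [LinearMap.sub_apply, LinearMap.comp_apply, AlgHom.toLinearMap_apply, sub_mul,
        Finset.sum_sub_distrib]
      rw [h1, h2, sub_self]) a
  simpa [sub_eq_zero] using this

/-- A Poisson structure descends along a surjection whose kernel is a Poisson ideal. -/
theorem descend {A : Type w} [CommRing A] [Algebra k A] (PB : PoissonStr k B)
    (φ : B →ₐ[k] A) (hφ : Function.Surjective φ)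
    (hk : ∀ p a : B, φ a = 0 → φ (PB.br p a) = 0) :
    ∃ PA : PoissonStr k A, IsPoissonHom PB PA φ := by
  obtain ⟨s, hs⟩ := hφ.hasRightInverse
  have key : ∀ x x' y y' : B, φ x = φ x' → φ y = φ y' → φ (PB.br x y) = φ (PB.br x' y') := by
    intro x x' y y' hx hy
    have h1 := hk x (y - y') (by rw [map_sub, hy, sub_self])
    have h2 := hk y' (x - x') (by rw [map_sub, hx, sub_self])
    rw [map_sub, map_sub, sub_eq_zero] at h1 h2
    rw [h1, PB.skew x, PB.skew x', map_neg, map_neg, h2]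
  let br : A →ₗ[k] A →ₗ[k] A := LinearMap.mk₂ k (fun a b => φ (PB.br (s a) (s b)))
    (by
      intro a a' b
      rw [← map_add, ← LinearMap.add_apply, ← map_add]
      exact key _ _ _ _ (by simp [hs _]) rfl)
    (by
      intro c a b
      rw [← map_smul, ← LinearMap.smul_apply, ← map_smul]
      exact key _ _ _ _ (by simp [hs _]) rfl)
    (by
      intro a b b'
      rw [← map_add, ← map_add]
      exact key _ _ _ _ rfl (by simp [hs _]))
    (by
      intro c a b
      rw [← map_smul, ← map_smul]
      exact key _ _ _ _ rfl (by simp [hs _]))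
  have hbr : ∀ x y, br (φ x) (φ y) = φ (PB.br x y) := fun x y =>
    key _ _ _ _ (hs _) (hs _)
  refine ⟨⟨br, ?_, ?_, ?_⟩, fun a b => (hbr a b).symm⟩
  · intro a
    obtain ⟨a, rfl⟩ := hφ a
    rw [hbr, PB.br_self, map_zero]
  · intro a b c
    obtain ⟨a, rfl⟩ := hφ a
    obtain ⟨b, rfl⟩ := hφ b
    obtain ⟨c, rfl⟩ := hφ c
    simp only [hbr]
    rw [PB.jacobi, map_add]
  · intro a b c
    obtain ⟨a, rfl⟩ := hφ a
    obtain ⟨b, rfl⟩ := hφ b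
    obtain ⟨c, rfl⟩ := hφ c
    rw [← map_mul]
    simp only [hbr]
    rw [PB.leibniz, map_add, map_mul, map_mul]

/-- The tensor Poisson structure descends to a quotient. -/
theorem descend_tensor {A : Type w} [CommRing A] [Algebra k A] (PB : PoissonStr k B)
    (PA : PoissonStr k A) (φ : B →ₐ[k] A) (hφ : Function.Surjective φ)
    (hPA : IsPoissonHom PB PA φ) (T : PoissonStr k (B ⊗[k] B))
    (hT : IsTensorPoissonStr PB PB T) :
    ∃ T' : PoissonStr k (A ⊗[k] A), IsTensorPoissonStr PA PA T' ∧
      IsPoissonHom T T' (Algebra.TensorProduct.map φ φ) := by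
  have hsurj : Function.Surjective (Algebra.TensorProduct.map φ φ) :=
    TensorProduct.map_surjective hφ hφ
  have hgen : ∀ a : B, φ a = 0 → ∀ x : B ⊗[k] B,
      Algebra.TensorProduct.map φ φ (T.br x (a ⊗ₜ 1)) = 0 ∧
      Algebra.TensorProduct.map φ φ (T.br x (1 ⊗ₜ a)) = 0 := by
    intro a ha x
    induction x with
    | zero => simp
    | add x y hx hy => simp [hx.1, hx.2, hy.1, hy.2]
    | tmul p q =>
      rw [hT, hT]
      simp [PB.br_one, ha, hPA _ _]
  have hk : ∀ p a : B ⊗[k] B, Algebra.TensorProduct.map φ φ a = 0 →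
      Algebra.TensorProduct.map φ φ (T.br p a) = 0 := by
    intro p a ha
    have hmem : a ∈ RingHom.ker (Algebra.TensorProduct.map φ φ) := ha
    have hker := Algebra.TensorProduct.map_ker φ φ hφ hφ
    rw [hker, Ideal.map, Ideal.map, ← Ideal.span_union] at hmem
    have hle : ∀ z ∈ Ideal.span
        ((Algebra.TensorProduct.includeLeft : B →ₐ[k] B ⊗[k] B) '' (RingHom.ker φ) ∪
        (Algebra.TensorProduct.includeRight : B →ₐ[k] B ⊗[k] B) '' (RingHom.ker φ)),
        Algebra.TensorProduct.map φ φ z = 0 ∧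
        Algebra.TensorProduct.map φ φ (T.br p z) = 0 := by
      intro z hz
      induction hz using Submodule.span_induction with
      | mem z hz =>
        rcases hz with ⟨a, ha, rfl⟩ | ⟨a, ha, rfl⟩
        · have ha' : φ a = 0 := ha
          exact ⟨by simp [ha'], (hgen a ha' p).1⟩
        · have ha' : φ a = 0 := ha
          exact ⟨by simp [ha'], (hgen a ha' p).2⟩
      | zero => simp
      | add x y _ _ hx hy => simp [hx.1, hx.2, hy.1, hy.2]
      | smul c x _ hx =>
        rw [smul_eq_mul, T.leibniz]
        simp [hx.1, hx.2]
    exact (hle a hmem).2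
  obtain ⟨T', hT'⟩ := descend T _ hsurj hk
  refine ⟨T', ?_, hT'⟩
  intro p r q s
  obtain ⟨p, rfl⟩ := hφ p
  obtain ⟨q, rfl⟩ := hφ q
  obtain ⟨r, rfl⟩ := hφ r
  obtain ⟨s, rfl⟩ := hφ s
  have := hT' (p ⊗ₜ q) (r ⊗ₜ s)
  rw [hT] at this
  simp only [map_add, Algebra.TensorProduct.map_tmul, map_mul] at this
  rw [← this, hPA, hPA]

theorem gen_mem (PS : PoissonStr k B) (S : Set B) : S ⊆ poissonIdealGen PS S := by
  intro x hx
  rw [poissonIdealGen, SetLike.mem_coe, Submodule.mem_sInf]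
  exact fun I hI => hI.1 hx

theorem gen_poisson (PS : PoissonStr k B) (S : Set B) :
    IsPoissonIdeal PS (poissonIdealGen PS S) := by
  intro p a ha
  rw [poissonIdealGen, Submodule.mem_sInf] at ha ⊢
  exact fun I hI => hI.2 p a (ha I hI)

/-- A ring map which kills the generators and whose kernel is a Poisson ideal kills everything. -/
theorem gen_kill {A : Type w} [CommRing A] [Algebra k A] (PS : PoissonStr k B) (S : Set B)
    (φ : B →ₐ[k] A) (h0 : ∀ x ∈ S, φ x = 0)
    (hk : ∀ p a : B, φ a = 0 → φ (PS.br p a) = 0) :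
    ∀ x ∈ poissonIdealGen PS S, φ x = 0 := by
  intro x hx
  rw [poissonIdealGen, Submodule.mem_sInf] at hx
  exact hx (RingHom.ker φ) ⟨fun y hy => h0 y hy, fun p a ha => hk p a ha⟩

theorem poisson_hom_ker {A : Type w} [CommRing A] [Algebra k A] {PS : PoissonStr k B}
    {PA : PoissonStr k A} {φ : B →ₐ[k] A} (h : IsPoissonHom PS PA φ) :
    ∀ p a : B, φ a = 0 → φ (PS.br p a) = 0 := by
  intro p a ha
  rw [h, ha, map_zero]

/-- The antipode as an algebra map. -/
def antipodeHom (D : HopfData k B) : B →ₐ[k] B :=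
  AlgHom.ofLinearMap D.antipode (by
    have h := D.antipode_comul 1
    rw [map_one, Algebra.TensorProduct.one_def] at h
    simpa using h) (hopf_antipode_mul D)

theorem antipodeHom_apply (D : HopfData k B) (x : B) : antipodeHom D x = D.antipode x := rfl

/-- A Hopf structure descends along a surjection compatible with all structure maps. -/
theorem descend_hopf {A : Type w} [CommRing A] [Algebra k A] (D : HopfData k B)
    (φ : B →ₐ[k] A) (hφ : Function.Surjective φ)
    (Δ : A →ₐ[k] A ⊗[k] A) (ε : A →ₐ[k] k) (S : A →ₗ[k] A)
    (hΔ : ∀ x, Δ (φ x) = TensorProduct.map φ.toLinearMap φ.toLinearMap (D.comul x))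
    (hε : ∀ x, ε (φ x) = D.counit x) (hS : ∀ x, S (φ x) = φ (D.antipode x)) :
    ∃ D' : HopfData k A, D'.comul = Δ ∧ D'.counit = ε := by
  refine ⟨⟨⟨Δ, ε, ?_, ?_, ?_⟩, S, ?_, ?_⟩, rfl, rfl⟩
  · intro b
    obtain ⟨b, rfl⟩ := hφ b
    have hl : ∀ z : B ⊗[k] B, TensorProduct.map Δ.toLinearMap LinearMap.id
        (TensorProduct.map φ.toLinearMap φ.toLinearMap z) =
        TensorProduct.map (TensorProduct.map φ.toLinearMap φ.toLinearMap) φ.toLinearMap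
          (TensorProduct.map D.comul.toLinearMap LinearMap.id z) := by
      intro z
      induction z with
      | zero => simp
      | add x y hx hy => simp only [map_add, hx, hy]
      | tmul x y => simp [hΔ]
    have hr : ∀ z : B ⊗[k] B, TensorProduct.map LinearMap.id Δ.toLinearMap
        (TensorProduct.map φ.toLinearMap φ.toLinearMap z) =
        TensorProduct.map φ.toLinearMap (TensorProduct.map φ.toLinearMap φ.toLinearMap)
          (TensorProduct.map LinearMap.id D.comul.toLinearMap z) := by
      intro z
      induction z with
      | zero => simp
      | add x y hx hy => simp only [map_add, hx, hy]
      | tmul x y => simp [hΔ]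
    rw [hΔ, hl, hr, D.coassoc, TensorProduct.map_map_assoc_symm]
  · intro b
    obtain ⟨b, rfl⟩ := hφ b
    obtain ⟨s, hs⟩ := exists_rep D.toBialgData b
    have h := congrArg φ (D.counit_comul b)
    rw [hΔ]
    rw [hs] at h ⊢
    simpa [hε] using h
  · intro b
    obtain ⟨b, rfl⟩ := hφ b
    obtain ⟨s, hs⟩ := exists_rep D.toBialgData b
    have h := congrArg φ (D.comul_counit b)
    rw [hΔ]
    rw [hs] at h ⊢
    simpa [hε] using h
  · intro b
    obtain ⟨b, rfl⟩ := hφ b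
    obtain ⟨s, hs⟩ := exists_rep D.toBialgData b
    have h := congrArg φ (D.antipode_comul b)
    rw [hΔ]
    rw [hs] at h ⊢
    simpa [hε, hS] using h
  · intro b
    obtain ⟨b, rfl⟩ := hφ b
    obtain ⟨s, hs⟩ := exists_rep D.toBialgData b
    have h := congrArg φ (D.comul_antipode b)
    rw [hΔ]
    rw [hs] at h ⊢
    simpa [hε, hS] using h

end Helpers

/-- for Poisson Hopf algebra maps `f g : P → Q`, the Poisson ideal `J̄`
generated by `{f p − g p}` is stable under the antipode, so it is a Poisson Hopf ideal
and `Q ⧸ J̄` with the canonical projection is the coequalizer of `(f, g)` in the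
category of Poisson Hopf algebras. -/
theorem poissonHopf_coequalizer (k P Q : Type u) [Field k]
    [CommRing P] [Algebra k P] [CommRing Q] [Algebra k Q]
    (PP : PoissonStr k P) (PQ : PoissonStr k Q)
    (DP : HopfData k P) (DQ : HopfData k Q)
    (hP : IsPoissonBialg PP DP.toBialgData) (hQ : IsPoissonBialg PQ DQ.toBialgData)
    (f g : P →ₐ[k] Q)
    (hf : IsPoissonBialgHom PP PQ DP.toBialgData DQ.toBialgData f)
    (hg : IsPoissonBialgHom PP PQ DP.toBialgData DQ.toBialgData g)
    (J : Ideal Q) (hJdef : J = poissonIdealGen PQ (Set.range fun p => f p - g p)) :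
    (∀ x ∈ J, DQ.antipode x ∈ J) ∧
    ∃ (QS : PoissonStr k (Q ⧸ J)) (D' : HopfData k (Q ⧸ J)),
      IsPoissonBialg QS D'.toBialgData ∧
      IsPoissonBialgHom PQ QS DQ.toBialgData D'.toBialgData (Ideal.Quotient.mkₐ k J) ∧
      (∀ p : P, Ideal.Quotient.mkₐ k J (f p) = Ideal.Quotient.mkₐ k J (g p)) ∧
      ∀ (R : PoissonHopfBundle.{u, u} k) (h : Q →ₐ[k] R.carrier),
        IsPoissonBialgHom PQ R.str DQ.toBialgData R.hopf.toBialgData h →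
        (∀ p : P, h (f p) = h (g p)) →
        ∃! h' : (Q ⧸ J) →ₐ[k] R.carrier,
          IsPoissonBialgHom QS R.str D'.toBialgData R.hopf.toBialgData h' ∧
          ∀ x : Q, h' (Ideal.Quotient.mkₐ k J x) = h x := by
  subst hJdef
  set X : Set Q := Set.range fun p => f p - g p with hX
  set J := poissonIdealGen PQ X with hJ
  have hπ : Function.Surjective (Ideal.Quotient.mkₐ k J) := Ideal.Quotient.mkₐ_surjective k J
  have hπ0 : ∀ x, Ideal.Quotient.mkₐ k J x = 0 ↔ x ∈ J := fun x =>
    Ideal.Quotient.eq_zero_iff_mem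
  have hfg : ∀ p, Ideal.Quotient.mkₐ k J (f p) = Ideal.Quotient.mkₐ k J (g p) := by
    intro p
    rw [← sub_eq_zero, ← map_sub, hπ0]
    exact gen_mem PQ X ⟨p, rfl⟩
  -- the Poisson structure on the quotient
  obtain ⟨QS, hQS⟩ := descend PQ (Ideal.Quotient.mkₐ k J) hπ (by
    intro p a ha
    rw [hπ0] at ha ⊢
    exact gen_poisson PQ X p a ha)
  obtain ⟨T, hT, hTc⟩ := hQ
  have hQ' : IsPoissonBialg PQ DQ.toBialgData := ⟨T, hT, hTc⟩
  obtain ⟨T', hT', hTT'⟩ := descend_tensor PQ QS (Ideal.Quotient.mkₐ k J) hπ hQS T hT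
  -- stability under the antipode
  have hSJ : ∀ x ∈ J, Ideal.Quotient.mkₐ k J (DQ.antipode x) = 0 := by
    refine gen_kill PQ X ((Ideal.Quotient.mkₐ k J).comp (antipodeHom DQ)) ?_ ?_
    · rintro _ ⟨p, rfl⟩
      simp only [AlgHom.comp_apply, map_sub]
      rw [antipodeHom_apply, antipodeHom_apply, hom_antipode DP DQ f hf.2.1 hf.2.2,
        hom_antipode DP DQ g hg.2.1 hg.2.2, hfg, sub_self]
    · intro p a ha
      rw [AlgHom.comp_apply, antipodeHom_apply] at ha ⊢
      rw [hopf_antipode_br hQ', hQS, ha, map_zero, LinearMap.zero_apply]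
  refine ⟨fun x hx => (hπ0 _).1 (hSJ x hx), ?_⟩
  have hΔJ : ∀ x ∈ J, ((Algebra.TensorProduct.map (Ideal.Quotient.mkₐ k J)
      (Ideal.Quotient.mkₐ k J)).comp DQ.comul) x = 0 := by
    refine gen_kill PQ X _ ?_ (poisson_hom_ker (PA := T') ?_)
    · have hcomp : (Ideal.Quotient.mkₐ k J).toLinearMap ∘ₗ f.toLinearMap =
          (Ideal.Quotient.mkₐ k J).toLinearMap ∘ₗ g.toLinearMap := LinearMap.ext hfg
      rintro _ ⟨p, rfl⟩
      simp only [map_sub]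
      rw [sub_eq_zero]
      change TensorProduct.map (Ideal.Quotient.mkₐ k J).toLinearMap
          (Ideal.Quotient.mkₐ k J).toLinearMap (DQ.comul (f p)) =
        TensorProduct.map (Ideal.Quotient.mkₐ k J).toLinearMap
          (Ideal.Quotient.mkₐ k J).toLinearMap (DQ.comul (g p))
      rw [hf.2.1, hg.2.1, ← LinearMap.comp_apply, ← LinearMap.comp_apply,
        ← TensorProduct.map_comp, ← TensorProduct.map_comp, hcomp]
    · intro a b
      rw [AlgHom.comp_apply, hTc, hTT']
      rfl
  have hεJ : ∀ x ∈ J, DQ.counit x = 0 := by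
    refine gen_kill PQ X _ ?_ (fun p a _ => counit_br hQ' p a)
    rintro _ ⟨p, rfl⟩
    simp only [map_sub]
    rw [hf.2.2, hg.2.2, sub_self]
  obtain ⟨D', hD1, hD2⟩ := descend_hopf DQ (Ideal.Quotient.mkₐ k J) hπ
    (Ideal.Quotient.liftₐ J _ hΔJ) (Ideal.Quotient.liftₐ J _ hεJ)
    (Ideal.Quotient.liftₐ J ((Ideal.Quotient.mkₐ k J).comp (antipodeHom DQ)) hSJ).toLinearMap
    (fun x => rfl) (fun x => rfl) (fun x => rfl)
  have hc : ∀ x, D'.comul (Ideal.Quotient.mkₐ k J x) =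
      Algebra.TensorProduct.map (Ideal.Quotient.mkₐ k J) (Ideal.Quotient.mkₐ k J)
        (DQ.comul x) := by
    intro x
    rw [hD1]
    rfl
  have he : ∀ x, D'.counit (Ideal.Quotient.mkₐ k J x) = DQ.counit x := by
    intro x
    rw [hD2]
    rfl
  refine ⟨QS, D', ⟨T', hT', ?_⟩, ⟨hQS, hc, he⟩, hfg, ?_⟩
  · intro a b
    obtain ⟨a, rfl⟩ := hπ a
    obtain ⟨b, rfl⟩ := hπ b
    rw [← hQS, hc, hc, hc, hTc, hTT']
  · intro R h hh hhfg
    have hhJ : ∀ x ∈ J, h x = 0 := by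
      refine gen_kill PQ X h ?_ (poisson_hom_ker hh.1)
      rintro _ ⟨p, rfl⟩
      simp only [map_sub]
      rw [hhfg, sub_self]
    have hl : ∀ x, Ideal.Quotient.liftₐ J h hhJ (Ideal.Quotient.mkₐ k J x) = h x := fun x => rfl
    refine ⟨Ideal.Quotient.liftₐ J h hhJ, ⟨⟨?_, ?_, ?_⟩, hl⟩, ?_⟩
    · intro a b
      obtain ⟨a, rfl⟩ := hπ a
      obtain ⟨b, rfl⟩ := hπ b
      rw [← hQS, hl, hl, hl, hh.1]
    · intro a
      obtain ⟨a, rfl⟩ := hπ a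
      rw [hl, hh.2.1, hc]
      obtain ⟨s, hs⟩ := exists_rep DQ.toBialgData a
      rw [hs]
      simp only [map_sum, TensorProduct.map_tmul, Algebra.TensorProduct.map_tmul,
        AlgHom.toLinearMap_apply, hl]
    · intro a
      obtain ⟨a, rfl⟩ := hπ a
      rw [hl, hh.2.2, he]
    · rintro h' ⟨_, hh'⟩
      ext a
      obtain ⟨a, rfl⟩ := hπ a
      exact (hh' a).trans (hl a).symm
end

section
/- For any coalgebra C over a field k, the free Poisson algebra 𝒫(C) on the underlying vector space of C admits a unique Poisson bialgebra structure such that the canonical inclusion ī: C → 𝒫(C) is a coalgebra map, i.e. the comultiplication Δ̄ and counit ε̄ of 𝒫(C) are the unique Poisson algebra maps satisfying Δ̄ ∘ ī = (ī ⊗ ī) ∘ Δ_C and ε̄ ∘ ī = ε_C. -/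
open TensorProduct

universe u v w x

/-- The tensor-product bracket. -/
noncomputable def tensorBr {k : Type u} {A : Type v} {B : Type w} [CommRing k]
    [CommRing A] [Algebra k A] [CommRing B] [Algebra k B]
    (PA : PoissonStr k A) (PB : PoissonStr k B) :
    (A ⊗[k] B) →ₗ[k] (A ⊗[k] B) →ₗ[k] (A ⊗[k] B) :=
  TensorProduct.map₂ (LinearMap.mul k A) PB.br + TensorProduct.map₂ PA.br (LinearMap.mul k B)

theorem tensorBr_tmul {k : Type u} {A : Type v} {B : Type w} [CommRing k]
    [CommRing A] [Algebra k A] [CommRing B] [Algebra k B]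
    (PA : PoissonStr k A) (PB : PoissonStr k B) (p r : A) (q s : B) :
    tensorBr PA PB (p ⊗ₜ[k] q) (r ⊗ₜ[k] s)
      = (p * r) ⊗ₜ[k] PB.br q s + PA.br p r ⊗ₜ[k] (q * s) := by
  simp [tensorBr]

theorem PoissonStr.skew_s11 {k : Type u} {A : Type v} [CommRing k] [CommRing A] [Algebra k A]
    (PA : PoissonStr k A) (a b : A) : PA.br a b = - PA.br b a := by
  have h := PA.br_self (a + b)
  simp only [map_add, LinearMap.add_apply, PA.br_self, zero_add, add_zero] at h
  exact eq_neg_of_add_eq_zero_right h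

theorem PoissonStr.leibniz_left {k : Type u} {A : Type v} [CommRing k] [CommRing A] [Algebra k A]
    (PA : PoissonStr k A) (a b c : A) : PA.br (b * c) a = PA.br b a * c + b * PA.br c a := by
  rw [PA.skew_s11, PA.leibniz, PA.skew_s11 a b, PA.skew_s11 a c]; ring

theorem tensorBr_skew {k : Type u} {A : Type v} {B : Type w} [CommRing k]
    [CommRing A] [Algebra k A] [CommRing B] [Algebra k B]
    (PA : PoissonStr k A) (PB : PoissonStr k B) (x y : A ⊗[k] B) :
    tensorBr PA PB x y = - tensorBr PA PB y x := by
  induction x with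
  | zero => simp
  | add x x' h h' => simp only [map_add, LinearMap.add_apply, h, h', neg_add]
  | tmul p q =>
    induction y with
    | zero => simp
    | add x x' h h' => simp only [map_add, LinearMap.add_apply, h, h', neg_add]
    | tmul r s =>
      rw [tensorBr_tmul, tensorBr_tmul, PA.skew_s11 p r, PB.skew_s11 q s, mul_comm p r, mul_comm q s,
        TensorProduct.tmul_neg, TensorProduct.neg_tmul, neg_add]

/-- The tensor-product Poisson structure. -/
noncomputable def tensorPoisson {k : Type u} {A : Type v} {B : Type w} [CommRing k]
    [CommRing A] [Algebra k A] [CommRing B] [Algebra k B]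
    (PA : PoissonStr k A) (PB : PoissonStr k B) : PoissonStr k (A ⊗[k] B) where
  br := tensorBr PA PB
  br_self x := by
    induction x with
    | zero => simp
    | tmul p q => simp [tensorBr_tmul, PA.br_self, PB.br_self]
    | add x y hx hy =>
      simp only [map_add, LinearMap.add_apply, hx, hy]
      rw [tensorBr_skew PA PB x y]; simp
  jacobi x y z := by
    induction x with
    | zero => simp
    | add x x' h h' => simp only [map_add, LinearMap.add_apply, h, h']; abel
    | tmul a a' =>
    induction y with
    | zero => simp
    | add x x' h h' => simp only [map_add, LinearMap.add_apply, h, h']; abel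
    | tmul b b' =>
    induction z with
    | zero => simp
    | add x x' h h' => simp only [map_add, h, h']; abel
    | tmul c c' =>
      simp only [tensorBr_tmul, map_add, LinearMap.add_apply, PA.leibniz, PB.leibniz,
        PA.leibniz_left, PB.leibniz_left, PA.jacobi a b c, PB.jacobi a' b' c',
        TensorProduct.tmul_add, TensorProduct.add_tmul]
      rw [PA.skew_s11 b a, PB.skew_s11 b' a']
      simp only [mul_comm, mul_left_comm, mul_neg, neg_mul, TensorProduct.neg_tmul,
        TensorProduct.tmul_neg]
      abel
  leibniz x y z := by
    induction x with
    | zero => simp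
    | add x x' h h' => simp only [map_add, LinearMap.add_apply, h, h', add_mul, mul_add]; abel
    | tmul a a' =>
    induction y with
    | zero => simp
    | add x x' h h' => simp only [map_add, LinearMap.add_apply, h, h', add_mul]; abel
    | tmul b b' =>
    induction z with
    | zero => simp
    | add x x' h h' => simp only [map_add, h, h', mul_add]; abel
    | tmul c c' =>
      simp only [tensorBr_tmul, PA.leibniz, PB.leibniz, Algebra.TensorProduct.tmul_mul_tmul,
        TensorProduct.tmul_add, TensorProduct.add_tmul, add_mul, mul_add]
      simp only [mul_comm, mul_left_comm]
      abel

theorem tensorPoisson_tmul {k : Type u} {A : Type v} {B : Type w} [CommRing k]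
    [CommRing A] [Algebra k A] [CommRing B] [Algebra k B]
    (PA : PoissonStr k A) (PB : PoissonStr k B) (p r : A) (q s : B) :
    (tensorPoisson PA PB).br (p ⊗ₜ[k] q) (r ⊗ₜ[k] s)
      = (p * r) ⊗ₜ[k] PB.br q s + PA.br p r ⊗ₜ[k] (q * s) := tensorBr_tmul PA PB p r q s

/-- The trivial Poisson structure. -/
def trivPoisson (k : Type u) [CommRing k] : PoissonStr k k where
  br := 0
  br_self := by simp
  jacobi := by simp
  leibniz := by simp

/-- Being Poisson on a tensor product can be checked on pure tensors. -/
theorem isPoissonHom_of_tmul {k : Type u} {A : Type v} {B : Type w} {Q : Type x} [CommRing k]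
    [CommRing A] [Algebra k A] [CommRing B] [Algebra k B] [CommRing Q] [Algebra k Q]
    (PA : PoissonStr k A) (PB : PoissonStr k B) (PQ : PoissonStr k Q) (f : A ⊗[k] B →ₐ[k] Q)
    (h : ∀ p r q s, f ((tensorPoisson PA PB).br (p ⊗ₜ[k] q) (r ⊗ₜ[k] s))
      = PQ.br (f (p ⊗ₜ[k] q)) (f (r ⊗ₜ[k] s))) :
    IsPoissonHom (tensorPoisson PA PB) PQ f := by
  intro x y
  induction x with
  | zero => simp
  | add x x' h h' => simp only [map_add, LinearMap.add_apply, h, h']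
  | tmul a a' =>
  induction y with
  | zero => simp
  | add x x' h h' => simp only [map_add, h, h']
  | tmul b b' => exact h _ _ _ _

theorem isPoissonHom_map {k : Type u} {A A' B B' : Type v} [CommRing k]
    [CommRing A] [Algebra k A] [CommRing B] [Algebra k B]
    [CommRing A'] [Algebra k A'] [CommRing B'] [Algebra k B']
    {PA : PoissonStr k A} {PB : PoissonStr k B} {PA' : PoissonStr k A'} {PB' : PoissonStr k B'}
    {f : A →ₐ[k] A'} {g : B →ₐ[k] B'} (hf : IsPoissonHom PA PA' f) (hg : IsPoissonHom PB PB' g) :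
    IsPoissonHom (tensorPoisson PA PB) (tensorPoisson PA' PB') (Algebra.TensorProduct.map f g) := by
  apply isPoissonHom_of_tmul
  intro p r q s
  simp [tensorPoisson_tmul, hf p r, hg q s]

theorem isPoissonHom_comp {k : Type u} {A B Q : Type v} [CommRing k]
    [CommRing A] [Algebra k A] [CommRing B] [Algebra k B] [CommRing Q] [Algebra k Q]
    {PA : PoissonStr k A} {PB : PoissonStr k B} {PQ : PoissonStr k Q}
    {g : B →ₐ[k] Q} {f : A →ₐ[k] B} (hg : IsPoissonHom PB PQ g) (hf : IsPoissonHom PA PB f) :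
    IsPoissonHom PA PQ (g.comp f) := fun a b => by
  simp [hf a b, hg (f a) (f b)]

theorem isPoissonHom_assoc_symm {k : Type u} {A : Type v} [CommRing k]
    [CommRing A] [Algebra k A] (PA : PoissonStr k A) :
    IsPoissonHom (tensorPoisson PA (tensorPoisson PA PA)) (tensorPoisson (tensorPoisson PA PA) PA)
      ((Algebra.TensorProduct.assoc k k k A A A).symm : _ →ₐ[k] _) := by
  apply isPoissonHom_of_tmul
  intro p r x y
  induction x with
  | zero => simp
  | add x x' h h' => simp only [map_add, TensorProduct.tmul_add, LinearMap.add_apply, h, h']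
  | tmul a a' =>
  induction y with
  | zero => simp
  | add x x' h h' => simp only [map_add, TensorProduct.tmul_add, h, h']
  | tmul b b' =>
    simp [tensorPoisson_tmul, TensorProduct.tmul_add, TensorProduct.add_tmul, add_assoc]

theorem isPoissonHom_lid {k A : Type u} [CommRing k]
    [CommRing A] [Algebra k A] (PA : PoissonStr k A) :
    IsPoissonHom (tensorPoisson (trivPoisson k) PA) PA
      (Algebra.TensorProduct.lid k A : _ →ₐ[k] _) := by
  apply isPoissonHom_of_tmul
  intro p r x y
  simp [tensorPoisson_tmul, trivPoisson, mul_smul]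
  try rw [smul_comm]

theorem isPoissonHom_rid {k A : Type u} [CommRing k]
    [CommRing A] [Algebra k A] (PA : PoissonStr k A) :
    IsPoissonHom (tensorPoisson PA (trivPoisson k)) PA
      (Algebra.TensorProduct.rid k k A : _ →ₐ[k] _) := by
  apply isPoissonHom_of_tmul
  intro p r x y
  simp [tensorPoisson_tmul, trivPoisson, mul_smul]
  try rw [smul_comm]

theorem BialgData.ext_comul {k : Type u} {B : Type v} [CommRing k] [CommRing B] [Algebra k B]
    (D E : BialgData k B) (h : D.comul = E.comul) : D = E := by
  have hc : D.counit = E.counit := by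
    ext b
    have h1 := congrArg D.counit (E.counit_comul b)
    have h2 := congrArg E.counit (D.comul_counit b)
    rw [← h1, ← h2, h]
    induction E.comul b with
    | zero => simp
    | add x y hx hy => simp only [map_add, hx, hy]
    | tmul x y => simp [mul_comm]
  cases D; cases E; cases h; cases hc; rfl

/-- The tensor-product Poisson structure is unique. -/
theorem eq_tensorPoisson {k : Type u} {A : Type v} {B : Type w} [CommRing k]
    [CommRing A] [Algebra k A] [CommRing B] [Algebra k B]
    {PA : PoissonStr k A} {PB : PoissonStr k B} {T : PoissonStr k (A ⊗[k] B)}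
    (h : IsTensorPoissonStr PA PB T) : T = tensorPoisson PA PB := by
  have : T.br = (tensorPoisson PA PB).br := by
    ext p q r s
    simp [h p r q s, tensorPoisson_tmul]
  cases T
  simp only [tensorPoisson] at this ⊢
  cases this
  rfl

/-- for a coalgebra `C`, the free Poisson algebra `𝒫(C)` on the
underlying vector space of `C` admits a unique Poisson bialgebra structure whose
comultiplication and counit are the unique Poisson algebra maps satisfying
`Δ̄ ∘ ī = (ī ⊗ ī) ∘ Δ_C` and `ε̄ ∘ ī = ε_C`; in particular `ī` is a coalgebra map. -/
theorem free_poisson_bialg_structure (k C P : Type u) [Field k]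
    [AddCommGroup C] [Module k C] (DC : CoalgData k C)
    [CommRing P] [Algebra k P] (PS : PoissonStr k P) (ι : C →ₗ[k] P)
    (hfree : ∀ (Q : Type u) [CommRing Q] [Algebra k Q],
      ∀ (QS : PoissonStr k Q) (f : C →ₗ[k] Q),
        ∃! g : P →ₐ[k] Q, IsPoissonHom PS QS g ∧ ∀ c : C, g (ι c) = f c) :
    ∃! D : BialgData k P, IsPoissonBialg PS D ∧
      (∀ c : C, D.comul (ι c) = TensorProduct.map ι ι (DC.comul c)) ∧
      (∀ c : C, D.counit (ι c) = DC.counit c) := by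
  have huniq : ∀ (Q : Type u) [CommRing Q] [Algebra k Q] (QS : PoissonStr k Q)
      (f g : P →ₐ[k] Q), IsPoissonHom PS QS f → IsPoissonHom PS QS g →
      (∀ c, f (ι c) = g (ι c)) → f = g := by
    intro Q _ _ QS f g hf hg h
    obtain ⟨_, _, hu⟩ := hfree Q QS (g.toLinearMap ∘ₗ ι)
    rw [hu f ⟨hf, fun c => by simp [h]⟩, hu g ⟨hg, fun c => by simp⟩]
  obtain ⟨Δ, ⟨hΔP, hΔ⟩, -⟩ := hfree (P ⊗[k] P) (tensorPoisson PS PS)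
    (TensorProduct.map ι ι ∘ₗ DC.comul)
  obtain ⟨ε, ⟨hεP, hε⟩, -⟩ := hfree k (trivPoisson k) DC.counit
  simp only [LinearMap.comp_apply] at hΔ
  have hid : IsPoissonHom PS PS (AlgHom.id k P) := fun a b => by simp
  have hcoassoc : (Algebra.TensorProduct.map Δ (AlgHom.id k P)).comp Δ =
      (((Algebra.TensorProduct.assoc k k k P P P).symm : _ →ₐ[k] _).comp
        (Algebra.TensorProduct.map (AlgHom.id k P) Δ)).comp Δ := by
    refine huniq _ (tensorPoisson (tensorPoisson PS PS) PS) _ _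
      (isPoissonHom_comp (isPoissonHom_map hΔP hid) hΔP)
      (isPoissonHom_comp (isPoissonHom_comp (isPoissonHom_assoc_symm PS)
        (isPoissonHom_map hid hΔP)) hΔP) ?_
    intro c
    have e1 : ∀ x : C ⊗[k] C, Algebra.TensorProduct.map Δ (AlgHom.id k P)
        (TensorProduct.map ι ι x) = TensorProduct.map (TensorProduct.map ι ι) ι
          (TensorProduct.map DC.comul LinearMap.id x) := by
      intro x
      induction x with
      | zero => simp
      | add x y hx hy => simp only [map_add, hx, hy]
      | tmul x y => simp [hΔ]
    have e2 : ∀ x : C ⊗[k] C, Algebra.TensorProduct.map (AlgHom.id k P) Δ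
        (TensorProduct.map ι ι x) = TensorProduct.map ι (TensorProduct.map ι ι)
          (TensorProduct.map LinearMap.id DC.comul x) := by
      intro x
      induction x with
      | zero => simp
      | add x y hx hy => simp only [map_add, hx, hy]
      | tmul x y => simp [hΔ]
    have e3 : ∀ x : C ⊗[k] (C ⊗[k] C), (Algebra.TensorProduct.assoc k k k P P P).symm
        (TensorProduct.map ι (TensorProduct.map ι ι) x) =
        TensorProduct.map (TensorProduct.map ι ι) ι ((TensorProduct.assoc k C C C).symm x) := by
      intro x
      induction x with
      | zero => simp
      | add x y hx hy => simp only [map_add, hx, hy]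
      | tmul a y =>
        induction y with
        | zero => simp
        | add x y hx hy => simp only [map_add, TensorProduct.tmul_add, hx, hy]
        | tmul x y => simp
    simp only [AlgHom.comp_apply, hΔ]
    rw [e1, e2, DC.coassoc]
    exact (e3 _).symm
  have hl : (((Algebra.TensorProduct.lid k P : _ →ₐ[k] _).comp
        (Algebra.TensorProduct.map ε (AlgHom.id k P))).comp Δ) = AlgHom.id k P := by
    refine huniq _ PS _ _ (isPoissonHom_comp (isPoissonHom_comp (isPoissonHom_lid PS)
        (isPoissonHom_map hεP hid)) hΔP) hid ?_
    intro c
    have e1 : ∀ x : C ⊗[k] C, Algebra.TensorProduct.lid k P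
        (Algebra.TensorProduct.map ε (AlgHom.id k P)
        (TensorProduct.map ι ι x)) = ι (TensorProduct.lid k C
          (TensorProduct.map DC.counit LinearMap.id x)) := by
      intro x
      induction x with
      | zero => simp
      | add x y hx hy => simp only [map_add, hx, hy]
      | tmul x y => simp [hε]
    have := e1 (DC.comul c)
    rw [DC.counit_comul] at this
    simpa [hΔ] using this
  have hr : (((Algebra.TensorProduct.rid k k P : _ →ₐ[k] _).comp
        (Algebra.TensorProduct.map (AlgHom.id k P) ε)).comp Δ) = AlgHom.id k P := by
    refine huniq _ PS _ _ (isPoissonHom_comp (isPoissonHom_comp (isPoissonHom_rid PS)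
        (isPoissonHom_map hid hεP)) hΔP) hid ?_
    intro c
    have e1 : ∀ x : C ⊗[k] C, Algebra.TensorProduct.rid k k P
        (Algebra.TensorProduct.map (AlgHom.id k P) ε
        (TensorProduct.map ι ι x)) = ι (TensorProduct.rid k C
          (TensorProduct.map LinearMap.id DC.counit x)) := by
      intro x
      induction x with
      | zero => simp
      | add x y hx hy => simp only [map_add, hx, hy]
      | tmul x y => simp [hε]
    have := e1 (DC.comul c)
    rw [DC.comul_counit] at this
    simpa [hΔ] using this
  refine ⟨⟨Δ, ε, fun b => DFunLike.congr_fun hcoassoc b, fun b => DFunLike.congr_fun hl b,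
    fun b => DFunLike.congr_fun hr b⟩, ⟨⟨tensorPoisson PS PS, tensorPoisson_tmul PS PS, hΔP⟩,
      hΔ, hε⟩, ?_⟩
  rintro D ⟨⟨T, hT, hD⟩, hD1, -⟩
  apply BialgData.ext_comul
  rw [eq_tensorPoisson hT] at hD
  exact huniq _ (tensorPoisson PS PS) _ _ hD hΔP fun c => by rw [hD1, hΔ]
end

section
/- The forgetful functor from the category of Poisson bialgebras over a field k to the category of coalgebras over k has a left adjoint; explicitly, the free Poisson bialgebra on a coalgebra C is the free Poisson algebra 𝒫(C) equipped with the comultiplication and counit extending those of C, and every coalgebra map f: C → H into a Poisson bialgebra H extends uniquely to a Poisson bialgebra map 𝒫(C) → H. -/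
open TensorProduct

universe u v w x

/-! ### Basic facts and the tensor product Poisson structure -/

namespace FreePois

section basics

variable {k : Type u} {A : Type v} {B : Type w} [CommRing k]
    [CommRing A] [Algebra k A] [CommRing B] [Algebra k B]

theorem br_skew (P : PoissonStr k A) (a b : A) : P.br a b = - P.br b a := by
  have h := P.br_self (a + b)
  simp only [map_add, LinearMap.add_apply, P.br_self, zero_add, add_zero] at h
  exact eq_neg_of_add_eq_zero_right h

theorem leibniz_left (P : PoissonStr k A) (a b c : A) :
    P.br (a * b) c = P.br a c * b + a * P.br b c := by
  rw [br_skew P (a * b) c, P.leibniz, br_skew P a c, br_skew P b c]; ring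

noncomputable def tbr (PA : PoissonStr k A) (PB : PoissonStr k B) :
    A ⊗[k] B →ₗ[k] A ⊗[k] B →ₗ[k] A ⊗[k] B :=
  TensorProduct.map₂ (LinearMap.mul k A) PB.br + TensorProduct.map₂ PA.br (LinearMap.mul k B)

theorem tbr_tmul (PA : PoissonStr k A) (PB : PoissonStr k B) (p r : A) (q s : B) :
    tbr PA PB (p ⊗ₜ[k] q) (r ⊗ₜ[k] s) = (p * r) ⊗ₜ[k] PB.br q s + PA.br p r ⊗ₜ[k] (q * s) := by
  simp [tbr]

theorem tbr_skew (PA : PoissonStr k A) (PB : PoissonStr k B) (x y : A ⊗[k] B) :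
    tbr PA PB x y = - tbr PA PB y x := by
  induction x using TensorProduct.induction_on with
  | zero => simp
  | add x1 x2 h1 h2 => simp only [map_add, LinearMap.add_apply, h1, h2, neg_add]
  | tmul p q =>
    induction y using TensorProduct.induction_on with
    | zero => simp
    | add x1 x2 h1 h2 => simp only [map_add, LinearMap.add_apply, h1, h2, neg_add]
    | tmul r s =>
      rw [tbr_tmul, tbr_tmul, br_skew PB q s, br_skew PA p r, mul_comm p r, mul_comm q s]
      simp only [TensorProduct.tmul_neg, TensorProduct.neg_tmul, neg_add]

theorem tbr_jacobi (PA : PoissonStr k A) (PB : PoissonStr k B) (x y z : A ⊗[k] B) :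
    tbr PA PB x (tbr PA PB y z) = tbr PA PB (tbr PA PB x y) z + tbr PA PB y (tbr PA PB x z) := by
  induction x using TensorProduct.induction_on with
  | zero => simp
  | add x1 x2 h1 h2 => simp only [map_add, LinearMap.add_apply, h1, h2]; abel
  | tmul p q =>
    induction y using TensorProduct.induction_on with
    | zero => simp
    | add x1 x2 h1 h2 => simp only [map_add, LinearMap.add_apply, h1, h2]; abel
    | tmul r s =>
      induction z using TensorProduct.induction_on with
      | zero => simp
      | add x1 x2 h1 h2 => simp only [map_add, h1, h2]; abel
      | tmul t u =>
        simp only [tbr_tmul, map_add, LinearMap.add_apply, PA.leibniz, PB.leibniz,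
          leibniz_left PA, leibniz_left PB, PA.jacobi p r t, PB.jacobi q s u,
          TensorProduct.tmul_add, TensorProduct.add_tmul]
        rw [br_skew PA r p, br_skew PB s q]
        simp only [mul_neg, TensorProduct.tmul_neg, TensorProduct.neg_tmul,
          mul_comm, mul_left_comm]
        abel

theorem tbr_leibniz (PA : PoissonStr k A) (PB : PoissonStr k B) (x y z : A ⊗[k] B) :
    tbr PA PB x (y * z) = tbr PA PB x y * z + y * tbr PA PB x z := by
  induction x using TensorProduct.induction_on with
  | zero => simp
  | add x1 x2 h1 h2 => simp only [map_add, LinearMap.add_apply, h1, h2]; ring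
  | tmul p q =>
    induction y using TensorProduct.induction_on with
    | zero => simp
    | add x1 x2 h1 h2 => simp only [map_add, add_mul, h1, h2]; ring
    | tmul r s =>
      induction z using TensorProduct.induction_on with
      | zero => simp
      | add x1 x2 h1 h2 => simp only [map_add, mul_add, h1, h2]; ring
      | tmul t u =>
        simp only [tbr_tmul, Algebra.TensorProduct.tmul_mul_tmul, PA.leibniz, PB.leibniz,
          TensorProduct.tmul_add, TensorProduct.add_tmul, add_mul, mul_add]
        simp only [mul_comm, mul_left_comm]
        abel

theorem tbr_self (PA : PoissonStr k A) (PB : PoissonStr k B) (x : A ⊗[k] B) :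
    tbr PA PB x x = 0 := by
  induction x using TensorProduct.induction_on with
  | zero => simp
  | add x1 x2 h1 h2 =>
    simp only [map_add, LinearMap.add_apply, h1, h2]
    rw [tbr_skew PA PB x1 x2]; simp
  | tmul p q => simp [tbr_tmul, PA.br_self, PB.br_self]

noncomputable def tens (PA : PoissonStr k A) (PB : PoissonStr k B) : PoissonStr k (A ⊗[k] B) where
  br := tbr PA PB
  br_self := tbr_self PA PB
  jacobi := tbr_jacobi PA PB
  leibniz := tbr_leibniz PA PB

theorem tens_tmul (PA : PoissonStr k A) (PB : PoissonStr k B) (p r : A) (q s : B) :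
    (tens PA PB).br (p ⊗ₜ[k] q) (r ⊗ₜ[k] s) =
      (p * r) ⊗ₜ[k] PB.br q s + PA.br p r ⊗ₜ[k] (q * s) := tbr_tmul PA PB p r q s

/-- An algebra map out of a tensor product is Poisson if it is on pure tensors. -/
theorem isPoissonHom_tens {D : Type x} [CommRing D] [Algebra k D]
    (PA : PoissonStr k A) (PB : PoissonStr k B) (PD : PoissonStr k D) (f : A ⊗[k] B →ₐ[k] D)
    (h : ∀ (p r : A) (q s : B), f ((p * r) ⊗ₜ[k] PB.br q s + PA.br p r ⊗ₜ[k] (q * s)) =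
      PD.br (f (p ⊗ₜ q)) (f (r ⊗ₜ s))) : IsPoissonHom (tens PA PB) PD f := by
  intro x y
  induction x using TensorProduct.induction_on with
  | zero => simp
  | add x1 x2 h1 h2 => simp only [map_add, LinearMap.add_apply, h1, h2]
  | tmul p q =>
    induction y using TensorProduct.induction_on with
    | zero => simp
    | add x1 x2 h1 h2 => simp only [map_add, h1, h2]
    | tmul r s => rw [tens_tmul]; exact h p r q s

theorem tens_unique (PA : PoissonStr k A) (PB : PoissonStr k B) (T : PoissonStr k (A ⊗[k] B))
    (hT : IsTensorPoissonStr PA PB T) (a b : A ⊗[k] B) : T.br a b = (tens PA PB).br a b :=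
  (isPoissonHom_tens PA PB T (AlgHom.id k _) (fun p r q s => (hT p r q s).symm) a b).symm

def zeroStr (k : Type u) [CommRing k] : PoissonStr k k where
  br := 0
  br_self := by simp
  jacobi := by simp
  leibniz := by simp

end basics

section maps

variable {k : Type u} {A A' B B' D : Type u} [CommRing k]
    [CommRing A] [Algebra k A] [CommRing B] [Algebra k B]
    [CommRing A'] [Algebra k A'] [CommRing B'] [Algebra k B'] [CommRing D] [Algebra k D]

theorem comp_poisson {PA : PoissonStr k A} {PB : PoissonStr k B} {PD : PoissonStr k D}
    {f : A →ₐ[k] B} {g : B →ₐ[k] D} (hg : IsPoissonHom PB PD g) (hf : IsPoissonHom PA PB f) :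
    IsPoissonHom PA PD (g.comp f) := by
  intro a b
  simp only [AlgHom.comp_apply]
  rw [hf, hg]

theorem id_poisson (PA : PoissonStr k A) : IsPoissonHom PA PA (AlgHom.id k A) := fun _ _ => rfl

theorem map_poisson {PA : PoissonStr k A} {PB : PoissonStr k B} {PA' : PoissonStr k A'}
    {PB' : PoissonStr k B'} {f : A →ₐ[k] A'} {g : B →ₐ[k] B'}
    (hf : IsPoissonHom PA PA' f) (hg : IsPoissonHom PB PB' g) :
    IsPoissonHom (tens PA PB) (tens PA' PB') (Algebra.TensorProduct.map f g) := by
  apply isPoissonHom_tens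
  intro p r q s
  simp only [map_add, Algebra.TensorProduct.map_tmul, tens_tmul, map_mul, hf p r, hg q s]

theorem lid_poisson (PA : PoissonStr k A) : IsPoissonHom (tens (zeroStr k) PA) PA
    (Algebra.TensorProduct.lid k A).toAlgHom := by
  apply isPoissonHom_tens
  intro p r q s
  simp [zeroStr, smul_smul, mul_comm]

theorem rid_poisson (PA : PoissonStr k A) : IsPoissonHom (tens PA (zeroStr k)) PA
    (Algebra.TensorProduct.rid k k A).toAlgHom := by
  apply isPoissonHom_tens
  intro p r q s
  simp [zeroStr, smul_smul, mul_comm]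

theorem assoc_poisson (PA : PoissonStr k A) (PB : PoissonStr k B) (PD : PoissonStr k D) :
    IsPoissonHom (tens PA (tens PB PD)) (tens (tens PA PB) PD)
    (Algebra.TensorProduct.assoc k k k A B D).symm.toAlgHom := by
  have key : IsPoissonHom (tens (tens PA PB) PD) (tens PA (tens PB PD))
      (Algebra.TensorProduct.assoc k k k A B D).toAlgHom := by
    apply isPoissonHom_tens
    intro x y q s
    induction x using TensorProduct.induction_on with
    | zero => simp
    | add x1 x2 h1 h2 =>
      simp only [add_mul, map_add, LinearMap.add_apply, TensorProduct.add_tmul] at h1 h2 ⊢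
      rw [← h1, ← h2]; abel
    | tmul a b =>
      induction y using TensorProduct.induction_on with
      | zero => simp
      | add x1 x2 h1 h2 =>
        simp only [mul_add, map_add, LinearMap.add_apply, TensorProduct.add_tmul] at h1 h2 ⊢
        rw [← h1, ← h2]; abel
      | tmul c d =>
        simp [tens_tmul, TensorProduct.add_tmul, TensorProduct.tmul_add, add_assoc]
  intro a b
  apply (Algebra.TensorProduct.assoc k k k A B D).injective
  have := key ((Algebra.TensorProduct.assoc k k k A B D).symm a)
    ((Algebra.TensorProduct.assoc k k k A B D).symm b)
  simp at this ⊢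
  exact this.symm

end maps

/-! ### The free Poisson algebra, as a quotient of terms -/

inductive PTerm (k C : Type u) : Type u
  | of : C → PTerm k C
  | scal : k → PTerm k C
  | add : PTerm k C → PTerm k C → PTerm k C
  | neg : PTerm k C → PTerm k C
  | mul : PTerm k C → PTerm k C → PTerm k C
  | br : PTerm k C → PTerm k C → PTerm k C

section free

variable {k : Type u} [Field k] {C : Type u} [AddCommGroup C] [Module k C]

def evalAt {Q : Type u} [CommRing Q] [Algebra k Q] (QS : PoissonStr k Q) (f : C →ₗ[k] Q) :
    PTerm k C → Q
  | .of c => f c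
  | .scal r => algebraMap k Q r
  | .add a b => evalAt QS f a + evalAt QS f b
  | .neg a => - evalAt QS f a
  | .mul a b => evalAt QS f a * evalAt QS f b
  | .br a b => QS.br (evalAt QS f a) (evalAt QS f b)

variable (k C) in
/-- Two terms are identified when they agree in every Poisson algebra. -/
def termSetoid : Setoid (PTerm k C) where
  r a b := ∀ (Q : Type u) [CommRing Q] [Algebra k Q] (QS : PoissonStr k Q) (f : C →ₗ[k] Q),
    evalAt QS f a = evalAt QS f b
  iseqv := ⟨fun _ _ _ _ _ _ => rfl, fun h Q _ _ QS f => (h Q QS f).symm,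
    fun h h' Q _ _ QS f => (h Q QS f).trans (h' Q QS f)⟩

variable (k C) in
def FP : Type u := Quotient (termSetoid k C)

def mk (a : PTerm k C) : FP k C := Quotient.mk (termSetoid k C) a

theorem mk_eq {a b : PTerm k C}
    (h : ∀ (Q : Type u) [CommRing Q] [Algebra k Q] (QS : PoissonStr k Q) (f : C →ₗ[k] Q),
      evalAt QS f a = evalAt QS f b) : mk a = mk b := Quotient.sound h

theorem ind {p : FP k C → Prop} (h : ∀ a, p (mk a)) (x : FP k C) : p x := Quotient.ind h x

instance : Add (FP k C) := ⟨Quotient.map₂ PTerm.add (by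
  intro a b h c d h' Q _ _ QS f; simp only [evalAt]; rw [h Q QS f, h' Q QS f])⟩
instance : Mul (FP k C) := ⟨Quotient.map₂ PTerm.mul (by
  intro a b h c d h' Q _ _ QS f; simp only [evalAt]; rw [h Q QS f, h' Q QS f])⟩
instance : Neg (FP k C) := ⟨Quotient.map PTerm.neg (by
  intro a b h Q _ _ QS f; simp only [evalAt]; rw [h Q QS f])⟩
instance : Zero (FP k C) := ⟨mk (.scal 0)⟩
instance : One (FP k C) := ⟨mk (.scal 1)⟩

def brFP : FP k C → FP k C → FP k C := Quotient.map₂ PTerm.br (by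
  intro a b h c d h' Q _ _ QS f; simp only [evalAt]; rw [h Q QS f, h' Q QS f])

theorem add_mk (a b : PTerm k C) : mk a + mk b = mk (.add a b) := rfl
theorem mul_mk (a b : PTerm k C) : mk a * mk b = mk (.mul a b) := rfl
theorem neg_mk (a : PTerm k C) : - mk a = mk (.neg a) := rfl
theorem zero_mk : (0 : FP k C) = mk (.scal 0) := rfl
theorem one_mk : (1 : FP k C) = mk (.scal 1) := rfl
theorem br_mk (a b : PTerm k C) : brFP (mk a) (mk b) = mk (.br a b) := rfl

instance : CommRing (FP k C) where
  add_assoc a b c := by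
    induction a using ind; induction b using ind; induction c using ind
    simp only [add_mk]; apply mk_eq; intros; simp only [evalAt]; ring
  zero_add a := by
    induction a using ind
    simp only [add_mk, zero_mk]; apply mk_eq; intros; simp [evalAt]
  add_zero a := by
    induction a using ind
    simp only [add_mk, zero_mk]; apply mk_eq; intros; simp [evalAt]
  add_comm a b := by
    induction a using ind; induction b using ind
    simp only [add_mk]; apply mk_eq; intros; simp only [evalAt]; ring
  left_distrib a b c := by
    induction a using ind; induction b using ind; induction c using ind
    simp only [add_mk, mul_mk]; apply mk_eq; intros; simp only [evalAt]; ring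
  right_distrib a b c := by
    induction a using ind; induction b using ind; induction c using ind
    simp only [add_mk, mul_mk]; apply mk_eq; intros; simp only [evalAt]; ring
  zero_mul a := by
    induction a using ind
    simp only [mul_mk, zero_mk]; apply mk_eq; intros; simp [evalAt]
  mul_zero a := by
    induction a using ind
    simp only [mul_mk, zero_mk]; apply mk_eq; intros; simp [evalAt]
  mul_assoc a b c := by
    induction a using ind; induction b using ind; induction c using ind
    simp only [mul_mk]; apply mk_eq; intros; simp only [evalAt]; ring
  one_mul a := by
    induction a using ind
    simp only [mul_mk, one_mk]; apply mk_eq; intros; simp [evalAt]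
  mul_one a := by
    induction a using ind
    simp only [mul_mk, one_mk]; apply mk_eq; intros; simp [evalAt]
  mul_comm a b := by
    induction a using ind; induction b using ind
    simp only [mul_mk]; apply mk_eq; intros; simp only [evalAt]; ring
  neg_add_cancel a := by
    induction a using ind
    simp only [neg_mk, add_mk, zero_mk]; apply mk_eq; intros; simp [evalAt]
  nsmul := nsmulRec
  zsmul := zsmulRec

instance : Algebra k (FP k C) where
  smul r x := mk (.scal r) * x
  algebraMap :=
    { toFun := fun r => mk (.scal r)
      map_one' := rfl
      map_zero' := rfl
      map_add' := fun a b => by rw [add_mk]; apply mk_eq; intros; simp [evalAt]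
      map_mul' := fun a b => by rw [mul_mk]; apply mk_eq; intros; simp [evalAt] }
  commutes' _ _ := mul_comm _ _
  smul_def' _ _ := rfl

theorem smul_mk (r : k) (a : PTerm k C) : r • mk a = mk (.mul (.scal r) a) := rfl

variable (k C) in
def strFP : PoissonStr k (FP k C) where
  br := LinearMap.mk₂ k brFP
    (fun a b c => by
      induction a using ind; induction b using ind; induction c using ind
      simp only [add_mk, br_mk]; apply mk_eq; intros; simp [evalAt])
    (fun r b c => by
      induction b using ind; induction c using ind
      simp only [smul_mk, br_mk]; apply mk_eq; intros; simp [evalAt, ← Algebra.smul_def])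
    (fun a b c => by
      induction a using ind; induction b using ind; induction c using ind
      simp only [add_mk, br_mk]; apply mk_eq; intros; simp [evalAt])
    (fun r b c => by
      induction b using ind; induction c using ind
      simp only [smul_mk, br_mk]; apply mk_eq; intros; simp [evalAt, ← Algebra.smul_def])
  br_self a := by
    induction a using ind
    simp only [LinearMap.mk₂_apply, br_mk, zero_mk]; apply mk_eq; intros
    simp [evalAt, PoissonStr.br_self]
  jacobi a b c := by
    induction a using ind; induction b using ind; induction c using ind
    simp only [LinearMap.mk₂_apply, br_mk, add_mk]; apply mk_eq; intros
    simp only [evalAt]; apply PoissonStr.jacobi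
  leibniz a b c := by
    induction a using ind; induction b using ind; induction c using ind
    simp only [LinearMap.mk₂_apply, br_mk, add_mk, mul_mk]; apply mk_eq; intros
    simp only [evalAt]; apply PoissonStr.leibniz

variable (k C) in
def incl : C →ₗ[k] FP k C where
  toFun c := mk (.of c)
  map_add' a b := by rw [add_mk]; apply mk_eq; intros; simp [evalAt]
  map_smul' r a := by
    simp only [RingHom.id_apply, smul_mk]; apply mk_eq; intros; simp [evalAt, Algebra.smul_def]

variable {Q : Type u} [CommRing Q] [Algebra k Q]

def lift (QS : PoissonStr k Q) (f : C →ₗ[k] Q) : FP k C →ₐ[k] Q where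
  toFun := Quotient.lift (evalAt QS f) (fun _ _ h => h Q QS f)
  map_one' := map_one (algebraMap k Q)
  map_zero' := map_zero (algebraMap k Q)
  map_add' a b := by induction a using ind; induction b using ind; rfl
  map_mul' a b := by induction a using ind; induction b using ind; rfl
  commutes' _ := rfl

theorem lift_poisson (QS : PoissonStr k Q) (f : C →ₗ[k] Q) :
    IsPoissonHom (strFP k C) QS (lift QS f) := by
  intro a b; induction a using ind; induction b using ind; rfl

theorem lift_incl (QS : PoissonStr k Q) (f : C →ₗ[k] Q) (c : C) :
    lift QS f (incl k C c) = f c := rfl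

theorem hom_ext (QS : PoissonStr k Q) {g h : FP k C →ₐ[k] Q}
    (hg : IsPoissonHom (strFP k C) QS g) (hh : IsPoissonHom (strFP k C) QS h)
    (e : ∀ c, g (incl k C c) = h (incl k C c)) : g = h := by
  ext x
  induction x using ind with | _ a
  induction a with
  | of c => exact e c
  | scal r => exact (g.commutes r).trans (h.commutes r).symm
  | add a b iha ihb => rw [← add_mk, map_add, map_add, iha, ihb]
  | neg a iha => rw [← neg_mk, map_neg, map_neg, iha]
  | mul a b iha ihb => rw [← mul_mk, map_mul, map_mul, iha, ihb]
  | br a b iha ihb =>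
    have h1 := hg (mk a) (mk b)
    have h2 := hh (mk a) (mk b)
    rw [iha, ihb, ← h2] at h1
    exact h1

/-! ### The bialgebra structure -/

noncomputable def comulFP (DC : CoalgData k C) : FP k C →ₐ[k] FP k C ⊗[k] FP k C :=
  lift (tens (strFP k C) (strFP k C)) (TensorProduct.map (incl k C) (incl k C) ∘ₗ DC.comul)

def counitFP (DC : CoalgData k C) : FP k C →ₐ[k] k := lift (zeroStr k) DC.counit

theorem comul_incl (DC : CoalgData k C) (c : C) :
    comulFP DC (incl k C c) = TensorProduct.map (incl k C) (incl k C) (DC.comul c) := rfl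

theorem counit_incl (DC : CoalgData k C) (c : C) :
    counitFP DC (incl k C c) = DC.counit c := rfl

theorem comul_poisson (DC : CoalgData k C) :
    IsPoissonHom (strFP k C) (tens (strFP k C) (strFP k C)) (comulFP DC) := lift_poisson _ _

theorem counit_poisson (DC : CoalgData k C) :
    IsPoissonHom (strFP k C) (zeroStr k) (counitFP DC) := lift_poisson _ _

theorem coassocFP (DC : CoalgData k C) :
    (Algebra.TensorProduct.map (comulFP DC) (AlgHom.id k _)).comp (comulFP DC) =
    (Algebra.TensorProduct.assoc k k k _ _ _).symm.toAlgHom.comp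
      ((Algebra.TensorProduct.map (AlgHom.id k _) (comulFP DC)).comp (comulFP DC)) := by
  apply hom_ext (tens (tens (strFP k C) (strFP k C)) (strFP k C))
  · exact comp_poisson (map_poisson (comul_poisson DC) (id_poisson _)) (comul_poisson DC)
  · exact comp_poisson (assoc_poisson _ _ _)
      (comp_poisson (map_poisson (id_poisson _) (comul_poisson DC)) (comul_poisson DC))
  · intro c
    have h := congrArg (TensorProduct.map (TensorProduct.map (incl k C) (incl k C)) (incl k C))
      (DC.coassoc c)
    have e1 : ∀ x : C ⊗[k] C, Algebra.TensorProduct.map (comulFP DC) (AlgHom.id k _)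
        (TensorProduct.map (incl k C) (incl k C) x) =
        TensorProduct.map (TensorProduct.map (incl k C) (incl k C)) (incl k C)
          (TensorProduct.map DC.comul LinearMap.id x) := by
      intro x
      induction x using TensorProduct.induction_on with
      | zero => simp
      | add x y hx hy => simp only [map_add, hx, hy]
      | tmul a b => simp [comul_incl]
    have e2 : ∀ x : C ⊗[k] C, Algebra.TensorProduct.map (AlgHom.id k _) (comulFP DC)
        (TensorProduct.map (incl k C) (incl k C) x) =
        TensorProduct.map (incl k C) (TensorProduct.map (incl k C) (incl k C))
          (TensorProduct.map LinearMap.id DC.comul x) := by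
      intro x
      induction x using TensorProduct.induction_on with
      | zero => simp
      | add x y hx hy => simp only [map_add, hx, hy]
      | tmul a b => simp [comul_incl]
    have e3 : ∀ x : C ⊗[k] (C ⊗[k] C), (Algebra.TensorProduct.assoc k k k _ _ _).symm
        (TensorProduct.map (incl k C) (TensorProduct.map (incl k C) (incl k C)) x) =
        TensorProduct.map (TensorProduct.map (incl k C) (incl k C)) (incl k C)
          ((TensorProduct.assoc k C C C).symm x) := by
      intro x
      induction x using TensorProduct.induction_on with
      | zero => simp
      | add x y hx hy => simp only [map_add, hx, hy]
      | tmul a y =>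
        induction y using TensorProduct.induction_on with
        | zero => simp
        | add x y hx hy => simp only [map_add, TensorProduct.tmul_add, hx, hy]
        | tmul b d => simp
    calc _ = _ := e1 _
      _ = _ := h
      _ = _ := (e3 _).symm
      _ = _ := congrArg _ (e2 _).symm

theorem counit_comulFP (DC : CoalgData k C) :
    (Algebra.TensorProduct.lid k (FP k C)).toAlgHom.comp
      ((Algebra.TensorProduct.map (counitFP DC) (AlgHom.id k _)).comp (comulFP DC)) =
    AlgHom.id k _ := by
  apply hom_ext (strFP k C)
  · exact comp_poisson (lid_poisson _)
      (comp_poisson (map_poisson (counit_poisson DC) (id_poisson _)) (comul_poisson DC))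
  · exact id_poisson _
  · intro c
    have e1 : ∀ x : C ⊗[k] C, Algebra.TensorProduct.lid k (FP k C)
        (Algebra.TensorProduct.map (counitFP DC) (AlgHom.id k _)
        (TensorProduct.map (incl k C) (incl k C) x)) =
        incl k C (TensorProduct.lid k C (TensorProduct.map DC.counit LinearMap.id x)) := by
      intro x
      induction x using TensorProduct.induction_on with
      | zero => simp
      | add x y hx hy => simp only [map_add, hx, hy]
      | tmul a b => simp [counit_incl]
    exact (e1 _).trans (congrArg _ (DC.counit_comul c))

theorem comul_counitFP (DC : CoalgData k C) :
    (Algebra.TensorProduct.rid k k (FP k C)).toAlgHom.comp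
      ((Algebra.TensorProduct.map (AlgHom.id k _) (counitFP DC)).comp (comulFP DC)) =
    AlgHom.id k _ := by
  apply hom_ext (strFP k C)
  · exact comp_poisson (rid_poisson _)
      (comp_poisson (map_poisson (id_poisson _) (counit_poisson DC)) (comul_poisson DC))
  · exact id_poisson _
  · intro c
    have e1 : ∀ x : C ⊗[k] C, Algebra.TensorProduct.rid k k (FP k C)
        (Algebra.TensorProduct.map (AlgHom.id k _) (counitFP DC)
        (TensorProduct.map (incl k C) (incl k C) x)) =
        incl k C (TensorProduct.rid k C (TensorProduct.map LinearMap.id DC.counit x)) := by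
      intro x
      induction x using TensorProduct.induction_on with
      | zero => simp
      | add x y hx hy => simp only [map_add, hx, hy]
      | tmul a b => simp [counit_incl]
    exact (e1 _).trans (congrArg _ (DC.comul_counit c))

noncomputable def biFP (DC : CoalgData k C) : BialgData k (FP k C) where
  comul := comulFP DC
  counit := counitFP DC
  coassoc b := DFunLike.congr_fun (coassocFP DC) b
  counit_comul b := DFunLike.congr_fun (counit_comulFP DC) b
  comul_counit b := DFunLike.congr_fun (comul_counitFP DC) b

noncomputable def bundleFP (DC : CoalgData k C) : PoissonBialgBundle.{u, u} k where
  carrier := FP k C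
  str := strFP k C
  bi := biFP DC
  compat := ⟨tens _ _, tens_tmul _ _, comul_poisson DC⟩

end free

/-- The counit of a Poisson bialgebra is automatically Poisson: applying `ε ⊗ ε` to
`Δ {a, b}` gives `ε {a, b} = ε {a, b} + ε {a, b}`. -/
theorem counit_br {k : Type u} {B : Type u} [CommRing k] [CommRing B] [Algebra k B]
    (PS : PoissonStr k B) (D : BialgData k B) (h : IsPoissonBialg PS D) (a b : B) :
    D.counit (PS.br a b) = 0 := by
  obtain ⟨T, hT, hc⟩ := h
  have key : ∀ x y : B ⊗[k] B,
      D.counit (TensorProduct.lid k B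
        (TensorProduct.map D.counit.toLinearMap LinearMap.id (T.br x y))) =
      D.counit (PS.br
        (TensorProduct.lid k B (TensorProduct.map D.counit.toLinearMap LinearMap.id x))
        (TensorProduct.lid k B (TensorProduct.map D.counit.toLinearMap LinearMap.id y))) +
      D.counit (PS.br
        (TensorProduct.rid k B (TensorProduct.map LinearMap.id D.counit.toLinearMap x))
        (TensorProduct.rid k B (TensorProduct.map LinearMap.id D.counit.toLinearMap y))) := by
    intro x y
    induction x using TensorProduct.induction_on with
    | zero => simp
    | add x1 x2 h1 h2 => simp only [map_add, LinearMap.add_apply, h1, h2]; ring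
    | tmul p q =>
      induction y using TensorProduct.induction_on with
      | zero => simp
      | add x1 x2 h1 h2 => simp only [map_add, h1, h2]; ring
      | tmul r s =>
        rw [hT]
        simp
        ring
  have h1 := key (D.comul a) (D.comul b)
  rw [← hc, D.counit_comul, D.counit_comul, D.counit_comul, D.comul_counit, D.comul_counit] at h1
  simpa using h1

end FreePois

/-- the forgetful functor from Poisson bialgebras to coalgebras has a
left adjoint: for every coalgebra `C` there is a Poisson bialgebra `𝒫(C)` which, as a
Poisson algebra, is free on the vector space `C`, whose comultiplication and counit
extend those of `C` along `ī`, and such that every coalgebra map `f : C → H` into a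
Poisson bialgebra `H` extends uniquely to a Poisson bialgebra map `𝒫(C) → H`. -/
theorem free_poisson_bialgebra (k : Type u) [Field k] (C : Type u)
    [AddCommGroup C] [Module k C] (DC : CoalgData k C) :
    ∃ (P : PoissonBialgBundle.{u, u} k) (ι : C →ₗ[k] P.carrier),
      (∀ (Q : Type u) [CommRing Q] [Algebra k Q],
        ∀ (QS : PoissonStr k Q) (f : C →ₗ[k] Q),
          ∃! g : P.carrier →ₐ[k] Q, IsPoissonHom P.str QS g ∧ ∀ c : C, g (ι c) = f c) ∧
      (∀ c : C, P.bi.comul (ι c) = TensorProduct.map ι ι (DC.comul c)) ∧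
      (∀ c : C, P.bi.counit (ι c) = DC.counit c) ∧
      ∀ (H : PoissonBialgBundle.{u, u} k) (f : C →ₗ[k] H.carrier),
        IsCoalgHom DC H.bi.toCoalgData f →
        ∃! g : P.carrier →ₐ[k] H.carrier,
          IsPoissonBialgHom P.str H.str P.bi H.bi g ∧ ∀ c : C, g (ι c) = f c := by
  refine ⟨FreePois.bundleFP DC, FreePois.incl k C, ?_, ?_, ?_, ?_⟩
  · intro Q _ _ QS f
    refine ⟨FreePois.lift QS f, ⟨FreePois.lift_poisson QS f, FreePois.lift_incl QS f⟩, ?_⟩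
    rintro g ⟨hg, hg'⟩
    exact FreePois.hom_ext QS hg (FreePois.lift_poisson QS f) hg'
  · exact FreePois.comul_incl DC
  · exact FreePois.counit_incl DC
  · intro H f hf
    obtain ⟨T, hT, hTc⟩ := H.compat
    have hΔ : IsPoissonHom H.str (FreePois.tens H.str H.str) H.bi.comul := fun a b =>
      (hTc a b).trans (FreePois.tens_unique _ _ T hT _ _)
    have hε : IsPoissonHom H.str (FreePois.zeroStr k) H.bi.counit := fun a b =>
      FreePois.counit_br H.str H.bi H.compat a b
    have hl := FreePois.lift_poisson H.str f
    have e1 : H.bi.comul.comp (FreePois.lift H.str f) =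
        (Algebra.TensorProduct.map (FreePois.lift H.str f) (FreePois.lift H.str f)).comp
          (FreePois.comulFP DC) := by
      apply FreePois.hom_ext (FreePois.tens H.str H.str) (FreePois.comp_poisson hΔ hl)
        (FreePois.comp_poisson (FreePois.map_poisson hl hl) (FreePois.comul_poisson DC))
      intro c
      have e : ∀ x : C ⊗[k] C,
          (Algebra.TensorProduct.map (FreePois.lift H.str f) (FreePois.lift H.str f))
            (TensorProduct.map (FreePois.incl k C) (FreePois.incl k C) x) =
            TensorProduct.map f f x := by
        intro x
        induction x using TensorProduct.induction_on with
        | zero => simp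
        | add x y hx hy => simp only [map_add, hx, hy]
        | tmul a b => simp [FreePois.lift_incl]
      exact (hf.1 c).trans (e _).symm
    have e2 : H.bi.counit.comp (FreePois.lift H.str f) = FreePois.counitFP DC :=
      FreePois.hom_ext (FreePois.zeroStr k) (FreePois.comp_poisson hε hl)
        (FreePois.counit_poisson DC) (fun c => hf.2 c)
    refine ⟨FreePois.lift H.str f, ⟨⟨hl, fun a => DFunLike.congr_fun e1 a,
      fun a => DFunLike.congr_fun e2 a⟩, FreePois.lift_incl H.str f⟩, ?_⟩
    rintro g ⟨hg, hg'⟩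
    exact FreePois.hom_ext H.str hg.1 hl hg'
end

section
/- The coalgebra map extension property for the free Poisson bialgebra: if C is a coalgebra, H a Poisson bialgebra, and f: C → H a coalgebra map, then the unique Poisson algebra map f̄: 𝒫(C) → H extending f (via f̄ ∘ ī = f) is automatically a coalgebra map, i.e. (f̄ ⊗ f̄) ∘ Δ̄ = Δ_H ∘ f̄ and ε_H ∘ f̄ = ε̄. -/
open TensorProduct

universe u v w x

theorem map_br_aux {k : Type u} {A : Type v} {B : Type w} [CommRing k]
    [CommRing A] [Algebra k A] [CommRing B] [Algebra k B]
    (PA : PoissonStr k A) (PB : PoissonStr k B)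
    (TA : PoissonStr k (A ⊗[k] A)) (TB : PoissonStr k (B ⊗[k] B))
    (hTA : IsTensorPoissonStr PA PA TA) (hTB : IsTensorPoissonStr PB PB TB)
    (f : A →ₐ[k] B) (hf : IsPoissonHom PA PB f) (s t : A ⊗[k] A) :
    Algebra.TensorProduct.map f f (TA.br s t) =
      TB.br (Algebra.TensorProduct.map f f s) (Algebra.TensorProduct.map f f t) := by
  induction s with
  | zero => simp
  | add x y hx hy => simp only [map_add, LinearMap.add_apply, hx, hy]
  | tmul p q =>
    induction t with
    | zero => simp
    | add x y hx hy => simp only [map_add, hx, hy]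
    | tmul r s =>
      simp [hTA p r q s, hTB (f p) (f r) (f q) (f s), hf p r, hf q s]

theorem counit_tensor_aux {k : Type u} {A : Type v} [CommRing k]
    [CommRing A] [Algebra k A] (PA : PoissonStr k A) (T : PoissonStr k (A ⊗[k] A))
    (hT : IsTensorPoissonStr PA PA T) (e : A →ₐ[k] k) (s t : A ⊗[k] A) :
    e (TensorProduct.lid k A (TensorProduct.map e.toLinearMap LinearMap.id (T.br s t))) =
      e (PA.br (TensorProduct.lid k A (TensorProduct.map e.toLinearMap LinearMap.id s))
          (TensorProduct.lid k A (TensorProduct.map e.toLinearMap LinearMap.id t))) +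
      e (PA.br (TensorProduct.rid k A (TensorProduct.map LinearMap.id e.toLinearMap s))
          (TensorProduct.rid k A (TensorProduct.map LinearMap.id e.toLinearMap t))) := by
  induction s with
  | zero => simp
  | add x y hx hy =>
    simp only [map_add, LinearMap.add_apply, hx, hy]
    ring
  | tmul p q =>
    induction t with
    | zero => simp
    | add x y hx hy =>
      simp only [map_add, hx, hy]
      ring
    | tmul r s =>
      simp [hT p r q s]
      ring

theorem counit_br_aux {k : Type u} {A : Type v} [CommRing k]
    [CommRing A] [Algebra k A] (PA : PoissonStr k A) (D : BialgData k A)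
    (h : IsPoissonBialg PA D) (a b : A) : D.counit (PA.br a b) = 0 := by
  obtain ⟨T, hT, hΔ⟩ := h
  have h1 := counit_tensor_aux PA T hT D.counit (D.comul a) (D.comul b)
  rw [← hΔ] at h1
  simp only [D.counit_comul, D.comul_counit] at h1
  exact left_eq_add.mp h1

/-- coalgebra-map extension property of the free Poisson bialgebra:
the unique Poisson algebra map `f̄ : 𝒫(C) → H` extending a coalgebra map `f : C → H`
is automatically a coalgebra map. -/
theorem free_extension_is_coalgHom (k C P H : Type u) [Field k]
    [AddCommGroup C] [Module k C] (DC : CoalgData k C)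
    [CommRing P] [Algebra k P] [CommRing H] [Algebra k H]
    (PS : PoissonStr k P) (ι : C →ₗ[k] P)
    (hfree : ∀ (Q : Type u) [CommRing Q] [Algebra k Q],
      ∀ (QS : PoissonStr k Q) (f : C →ₗ[k] Q),
        ∃! g : P →ₐ[k] Q, IsPoissonHom PS QS g ∧ ∀ c : C, g (ι c) = f c)
    (DP : BialgData k P) (hDP : IsPoissonBialg PS DP)
    (hcomul : ∀ c : C, DP.comul (ι c) = TensorProduct.map ι ι (DC.comul c))
    (hcounit : ∀ c : C, DP.counit (ι c) = DC.counit c)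
    (PH : PoissonStr k H) (DH : BialgData k H) (hH : IsPoissonBialg PH DH)
    (f : C →ₗ[k] H) (hf : IsCoalgHom DC DH.toCoalgData f)
    (fbar : P →ₐ[k] H) (hfbar : IsPoissonHom PS PH fbar)
    (hext : ∀ c : C, fbar (ι c) = f c) :
    (∀ x : P, DH.comul (fbar x) =
      TensorProduct.map fbar.toLinearMap fbar.toLinearMap (DP.comul x)) ∧
    (∀ x : P, DH.counit (fbar x) = DP.counit x) := by
  obtain ⟨TP, hTP, hΔP⟩ := hDP
  obtain ⟨TH, hTH, hΔH⟩ := hH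
  have hεP := counit_br_aux PS DP ⟨TP, hTP, hΔP⟩
  have hεH := counit_br_aux PH DH ⟨TH, hTH, hΔH⟩
  constructor
  · have key : DH.comul.comp fbar = (Algebra.TensorProduct.map fbar fbar).comp DP.comul := by
      refine (hfree (H ⊗[k] H) TH (DH.comul.toLinearMap ∘ₗ f)).unique ⟨?_, ?_⟩ ⟨?_, ?_⟩
      · intro a b
        simp only [AlgHom.comp_apply, hfbar a b, hΔH]
      · intro c
        simp [hext]
      · intro a b
        simp only [AlgHom.comp_apply, hΔP]
        exact map_br_aux PS PH TP TH hTP hTH fbar hfbar _ _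
      · intro c
        have h1 := hf.1 c
        have h2 : fbar.toLinearMap ∘ₗ ι = f := LinearMap.ext hext
        change Algebra.TensorProduct.map fbar fbar (DP.comul (ι c)) = DH.toCoalgData.comul (f c)
        rw [h1, hcomul, ← h2, TensorProduct.map_comp]
        rfl
    intro x
    exact DFunLike.congr_fun key x
  · have key : DH.counit.comp fbar = DP.counit := by
      let Z : PoissonStr k k := ⟨0, by simp, by simp, by simp⟩
      refine (hfree k Z DC.counit).unique ⟨?_, ?_⟩ ⟨?_, ?_⟩
      · intro a b
        simp [Z, hfbar a b, hεH]
      · intro c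
        have := hf.2 c
        simp only [AlgHom.comp_apply, hext]
        exact this
      · intro a b
        simp [Z, hεP]
      · exact hcounit
    intro x
    exact DFunLike.congr_fun key x
end
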